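/- Let H be a graph for which there exists a subgraph H' ⊆ H with d_2(H') = m_2(H) such that H' is strictly 2-balanced and H' is neither a tree nor a triangle, and set t = min{5/9, 1/m_2(H)}. Then for every edge probability p = p(n) with p·n^t → ∞ as n → ∞, w.h.p. Maker (moving first) has a winning strategy in the H_P-game on G_{n,p}. -/

import Mathlib

open scoped Classical

noncomputable section

namespace HGamePaper

/-! ### Maker-Breaker games -/

variable {X : Type*} {α β : Type*}

/-- Auxiliary game predicate: from a position (remaining unclaimed elements `rem`,
the set `claimed` of elements claimed so far by Maker, and a flag `makerTurn`
telling whose move it is), Maker has a strategy to end the game having claimed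
all elements of some winning set of `W`.  The fuel is the number of moves left. -/
def MakerWinsAux [DecidableEq X] (W : Set (Finset X)) :
    ℕ → Finset X → Finset X → Bool → Prop
  | 0, _, claimed, _ => ∃ A ∈ W, A ⊆ claimed
  | (k + 1), rem, claimed, makerTurn =>
      if rem = ∅ then ∃ A ∈ W, A ⊆ claimed
      else if makerTurn then
        ∃ x ∈ rem, MakerWinsAux W k (rem.erase x) (insert x claimed) false
      else
        ∀ x ∈ rem, MakerWinsAux W k (rem.erase x) claimed true

/-- Dual predicate: Breaker has a strategy guaranteeing that at the end of the game
Maker has not claimed all elements of any winning set. -/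
def BreakerWinsAux [DecidableEq X] (W : Set (Finset X)) :
    ℕ → Finset X → Finset X → Bool → Prop
  | 0, _, claimed, _ => ¬ ∃ A ∈ W, A ⊆ claimed
  | (k + 1), rem, claimed, makerTurn =>
      if rem = ∅ then ¬ ∃ A ∈ W, A ⊆ claimed
      else if makerTurn then
        ∀ x ∈ rem, BreakerWinsAux W k (rem.erase x) (insert x claimed) false
      else
        ∃ x ∈ rem, BreakerWinsAux W k (rem.erase x) claimed true

/-- Maker has a winning strategy in the Maker-Breaker game on the board `board`
with winning sets `W`; `makerStarts` records whether Maker makes the first move. -/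
def MakerWins [DecidableEq X] (board : Finset X) (W : Set (Finset X))
    (makerStarts : Bool) : Prop :=
  MakerWinsAux W board.card board ∅ makerStarts

/-- Breaker has a winning strategy in the Maker-Breaker game on the board `board`
with winning sets `W`; `makerStarts` records whether Maker makes the first move. -/
def BreakerWins [DecidableEq X] (board : Finset X) (W : Set (Finset X))
    (makerStarts : Bool) : Prop :=
  BreakerWinsAux W board.card board ∅ makerStarts

/-! ### Copies of a graph and the `H`-game -/

/-- `A` is the edge set of a copy of `H` in `G` (a subgraph of `G` isomorphic to `H`). -/
def IsCopy (H : SimpleGraph β) (G : SimpleGraph α) (A : Set (Sym2 α)) : Prop :=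
  ∃ f : β ↪ α, (∀ u v, H.Adj u v → G.Adj (f u) (f v)) ∧ A = Sym2.map f '' H.edgeSet

/-- The winning sets of the `H`-game: edge sets of copies of `H` in `G`. -/
def copyFinsets (H : SimpleGraph β) (G : SimpleGraph α) : Set (Finset (Sym2 α)) :=
  {A : Finset (Sym2 α) | IsCopy H G ↑A}

/-- Maker (moving first) has a winning strategy in the `H`-game played on the
edge set of `G`. -/
def MakerWinsHGame [Fintype α] (H : SimpleGraph β) (G : SimpleGraph α) : Prop :=
  MakerWins G.edgeSet.toFinset (copyFinsets H G) true

/-- Breaker has a winning strategy in the `H`-game played on the edge set of `G`,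
with Maker moving first. -/
def BreakerWinsHGame [Fintype α] (H : SimpleGraph β) (G : SimpleGraph α) : Prop :=
  BreakerWins G.edgeSet.toFinset (copyFinsets H G) true

/-! ### Densities -/

/-- The number of edges of a graph. -/
def numEdges (G : SimpleGraph α) : ℕ := G.edgeSet.ncard

/-- `d₂(G) = (e_G - 1)/(v_G - 2)`. -/
def d2 (G : SimpleGraph α) : ℝ :=
  ((numEdges G : ℝ) - 1) / ((Nat.card α : ℝ) - 2)

/-- `d₂` of a subgraph. -/
def subD2 {G : SimpleGraph α} (J : G.Subgraph) : ℝ :=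
  ((J.edgeSet.ncard : ℝ) - 1) / ((J.verts.ncard : ℝ) - 2)

/-- The 2-density `m₂(G) = max { d₂(J) : J ⊆ G, v_J ≥ 3 }`. -/
def m2 (G : SimpleGraph α) : ℝ :=
  sSup {x : ℝ | ∃ J : G.Subgraph, 3 ≤ J.verts.ncard ∧ x = subD2 J}

/-- `G` is strictly 2-balanced. -/
def IsStrictlyTwoBalanced (G : SimpleGraph α) : Prop :=
  m2 G = d2 G ∧ ∀ J : G.Subgraph, J ≠ ⊤ → 3 ≤ J.verts.ncard → subD2 J < m2 G

/-- `m(G) = max { e_{G'}/v_{G'} : G' ⊆ G, v_{G'} ≥ 1 }`. -/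
def mDensity (G : SimpleGraph α) : ℝ :=
  sSup {x : ℝ | ∃ J : G.Subgraph, 1 ≤ J.verts.ncard ∧
    x = (J.edgeSet.ncard : ℝ) / (J.verts.ncard : ℝ)}

/-- `ar(G) = max { e_{G'}/(v_{G'} - 1) : G' ⊆ G, v_{G'} ≥ 2 }`. -/
def arDensity (G : SimpleGraph α) : ℝ :=
  sSup {x : ℝ | ∃ J : G.Subgraph, 2 ≤ J.verts.ncard ∧
    x = (J.edgeSet.ncard : ℝ) / ((J.verts.ncard : ℝ) - 1)}

/-- `G` is a triangle, i.e. isomorphic to `K₃`. -/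
def IsTriangle (G : SimpleGraph α) : Prop :=
  Nonempty (G ≃g (⊤ : SimpleGraph (Fin 3)))

/-- The hypothesis of the main theorem: there is a subgraph `H' ⊆ H` with
`d₂(H') = m₂(H)` which is strictly 2-balanced and is neither a tree nor a triangle. -/
def GoodGraph (H : SimpleGraph β) : Prop :=
  ∃ H' : H.Subgraph, d2 H'.coe = m2 H ∧ IsStrictlyTwoBalanced H'.coe ∧
    ¬ H'.coe.IsTree ∧ ¬ IsTriangle H'.coe

/-! ### The random graph `G(n,p)` -/

/-- The probability that the binomial random graph `G(n,p)` satisfies the property `P`. -/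
def gnpProb (n : ℕ) (p : ℝ) (P : SimpleGraph (Fin n) → Prop) : ℝ :=
  ∑ G : SimpleGraph (Fin n),
    if P G then p ^ numEdges G * (1 - p) ^ (n.choose 2 - numEdges G) else 0

/-! ### The graph `H_P` -/

/-- The graph `H_P`: the disjoint union of `H` and a triangle, together with a path of
length 3 (two new internal vertices) joining a triangle vertex to the vertex `v₀` of `H`. -/
def HP (H : SimpleGraph β) (v₀ : β) : SimpleGraph (β ⊕ Fin 5) :=
  SimpleGraph.fromEdgeSet
    ((Sym2.map Sum.inl '' H.edgeSet) ∪
      {s(Sum.inr 0, Sum.inr 1), s(Sum.inr 0, Sum.inr 2), s(Sum.inr 1, Sum.inr 2),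
       s(Sum.inr 0, Sum.inr 3), s(Sum.inr 3, Sum.inr 4), s(Sum.inr 4, Sum.inl v₀)})

/-! ### `H`-cores and `H`-closed subgraphs -/

/-- An edge of `G` is open if it lies in exactly one copy of `H` in `G`. -/
def OpenEdge (H : SimpleGraph β) (G : SimpleGraph α) (e : Sym2 α) : Prop :=
  ∃! A : Set (Sym2 α), IsCopy H G A ∧ e ∈ A

/-- A copy of `H` in `G` (given by its edge set `A`) is unproblematic if it contains
at least two open edges. -/
def Unproblematic (H : SimpleGraph β) (G : SimpleGraph α) (A : Set (Sym2 α)) : Prop :=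
  ∃ e₁ ∈ A, ∃ e₂ ∈ A, e₁ ≠ e₂ ∧ OpenEdge H G e₁ ∧ OpenEdge H G e₂

/-- The defining properties of an `H`-core: every edge lies in a copy of `H`, and
every copy of `H` is problematic. -/
def CoreProps (H : SimpleGraph β) (G' : SimpleGraph α) : Prop :=
  (∀ e ∈ G'.edgeSet, ∃ A, IsCopy H G' A ∧ e ∈ A) ∧
    ∀ A, IsCopy H G' A → ¬ Unproblematic H G' A

/-- `G'` is an `H`-core of `G`: a maximal subgraph of `G` satisfying `CoreProps`. -/
def IsHCore (H : SimpleGraph β) (G G' : SimpleGraph α) : Prop :=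
  G' ≤ G ∧ CoreProps H G' ∧ ∀ G'' : SimpleGraph α, G'' ≤ G → G' ≤ G'' →
    CoreProps H G'' → G'' = G'

/-- `G''` is an `H`-closed subgraph of `core`: every copy of `H` in `core` is either
contained in `G''` or edge-disjoint from it. -/
def IsHClosed (H : SimpleGraph β) (core G'' : SimpleGraph α) : Prop :=
  G'' ≤ core ∧ ∀ A, IsCopy H core A → A ⊆ G''.edgeSet ∨ Disjoint A G''.edgeSet

/-- `G''` is a minimal (nonempty) `H`-closed subgraph of `core`. -/
def IsMinHClosed (H : SimpleGraph β) (core G'' : SimpleGraph α) : Prop :=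
  IsHClosed H core G'' ∧ G''.edgeSet.Nonempty ∧
    ∀ G''' : SimpleGraph α, IsHClosed H core G''' → G'''.edgeSet.Nonempty →
      G''' ≤ G'' → G''' = G''

/-! ### Playing the game from the middle -/

section Game

variable {X : Type*} [DecidableEq X] {W : Set (Finset X)}

/-- Maker, about to move, wins from the position with free elements `rem` and Maker's
elements `C`. -/
def WinsFrom (W : Set (Finset X)) (rem C : Finset X) : Prop :=
  MakerWinsAux W rem.card rem C true

lemma makerWinsAux_of_done (k : ℕ) :
    ∀ (rem C : Finset X) (b : Bool), (∃ A ∈ W, A ⊆ C) → MakerWinsAux W k rem C b := by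
  induction k with
  | zero => intro rem C b h; simpa [MakerWinsAux] using h
  | succ k ih =>
    intro rem C b h
    rw [MakerWinsAux]
    split_ifs with h0 hb
    · exact h
    · obtain ⟨x, hx⟩ := Finset.nonempty_iff_ne_empty.mpr h0
      obtain ⟨A, hA, hAC⟩ := h
      exact ⟨x, hx, ih _ _ _ ⟨A, hA, hAC.trans (Finset.subset_insert _ _)⟩⟩
    · exact fun x _ => ih _ _ _ h

lemma WinsFrom.of_done {rem C : Finset X} (h : ∃ A ∈ W, A ⊆ C) : WinsFrom W rem C :=
  makerWinsAux_of_done _ _ _ _ h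

lemma WinsFrom.step {rem C : Finset X} {x : X} (hx : x ∈ rem)
    (h : ∀ rem' ⊆ rem.erase x, (rem.erase x).card ≤ rem'.card + 1 →
      WinsFrom W rem' (insert x C)) : WinsFrom W rem C := by
  have hc : rem.card = (rem.erase x).card + 1 := (Finset.card_erase_add_one hx).symm
  have hne : rem ≠ ∅ := Finset.ne_empty_of_mem hx
  rw [WinsFrom, hc, MakerWinsAux, if_neg hne, if_pos rfl]
  refine ⟨x, hx, ?_⟩
  by_cases h0 : rem.erase x = ∅
  · have := h ∅ (Finset.empty_subset _) (by simp [h0])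
    rw [h0]
    simpa [WinsFrom, MakerWinsAux] using this
  · obtain ⟨y, hy⟩ := Finset.nonempty_iff_ne_empty.mpr h0
    rw [← Finset.card_erase_add_one hy, MakerWinsAux, if_neg h0, if_neg (by simp)]
    intro z hz
    have h1 := h ((rem.erase x).erase z) (Finset.erase_subset _ _)
      (by rw [Finset.card_erase_add_one hz])
    rw [WinsFrom, Finset.card_erase_of_mem hz] at h1
    rwa [Finset.card_erase_of_mem hy]

/-- Maker claims `x`, threatening to claim `y` in the next move. -/
lemma WinsFrom.threat {rem C : Finset X} {x y : X} (hx : x ∈ rem) (hy : y ∈ rem) (hxy : y ≠ x)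
    (h₁ : ∀ rem' ⊆ rem, rem.card ≤ rem'.card + 4 → WinsFrom W rem' (insert y (insert x C)))
    (h₂ : ∀ rem' ⊆ rem, rem.card ≤ rem'.card + 2 →
      (∀ z ∈ rem, z ≠ x → z ≠ y → z ∈ rem') → WinsFrom W rem' (insert x C)) :
    WinsFrom W rem C := by
  refine WinsFrom.step hx fun rem' hsub hcard => ?_
  have hc := Finset.card_erase_add_one hx
  have hyx : y ∈ rem.erase x := Finset.mem_erase.mpr ⟨hxy, hy⟩
  by_cases hy' : y ∈ rem'
  · refine WinsFrom.step hy' fun rem'' hsub' hcard' => ?_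
    have hc' := Finset.card_erase_add_one hy'
    refine h₁ rem'' ?_ (by omega)
    exact hsub'.trans ((Finset.erase_subset _ _).trans (hsub.trans (Finset.erase_subset _ _)))
  · have hsub2 : rem' ⊆ (rem.erase x).erase y := fun z hz =>
      Finset.mem_erase.mpr ⟨fun h => hy' (h ▸ hz), hsub hz⟩
    have heq : rem' = (rem.erase x).erase y := by
      refine Finset.eq_of_subset_of_card_le hsub2 ?_
      have := Finset.card_erase_add_one hyx
      omega
    refine h₂ rem' (hsub.trans (Finset.erase_subset _ _)) (by omega) ?_
    intro z hz hzx hzy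
    rw [heq]
    exact Finset.mem_erase.mpr ⟨hzy, Finset.mem_erase.mpr ⟨hzx, hz⟩⟩

/-- If Maker's potential, the number of `k`-sets of the family `𝓑` containing his elements, is
small compared to the number of free elements, then he can claim a `k`-set outside `𝓑`. -/
lemma WinsFrom.avoid (F : Finset X) (𝓑 : Finset (Finset X)) (N : ℝ) (hN : 0 ≤ N) (k : ℕ)
    (h𝓑 : ∀ K ∈ 𝓑, K.card = k) (C₀ : Finset X)
    (hpost : ∀ rem C D : Finset X, C₀ ⊆ C → C ⊆ C₀ ∪ F → D ⊆ C → D ⊆ F → D.card = k → D ∉ 𝓑 →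
      WinsFrom W rem C) (j : ℕ) :
    ∀ rem C D : Finset X, C₀ ⊆ C → C ⊆ C₀ ∪ F → D ⊆ C → D ⊆ F → Disjoint D rem →
      D.card + j = k → N + 2 * j ≤ ((rem ∩ F).card : ℝ) →
      (j.factorial : ℝ) * ((𝓑.filter (D ⊆ ·)).card : ℝ) < N ^ j →
      WinsFrom W rem C := by
  induction j with
  | zero =>
    intro rem C D hC hC' hD hDF _ hk _ hlt
    refine hpost rem C D hC hC' hD hDF hk fun hmem => ?_
    have : 0 < (𝓑.filter (D ⊆ ·)).card :=
      Finset.card_pos.mpr ⟨D, Finset.mem_filter.mpr ⟨hmem, subset_rfl⟩⟩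
    have h1 : (1 : ℝ) ≤ ((𝓑.filter (D ⊆ ·)).card : ℝ) := by exact_mod_cast this
    rw [pow_zero, Nat.factorial_zero, Nat.cast_one, one_mul] at hlt
    linarith
  | succ j ih =>
    intro rem C D hC hC' hD hDF hdisj hk hrem hlt
    have key : ∃ x ∈ rem ∩ F,
        (j.factorial : ℝ) * ((𝓑.filter (insert x D ⊆ ·)).card : ℝ) < N ^ j := by
      by_contra! hcon
      have hsum : ∑ x ∈ rem ∩ F, (𝓑.filter (insert x D ⊆ ·)).card
          ≤ (𝓑.filter (D ⊆ ·)).card * (j + 1) := by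
        simp_rw [Finset.card_filter (insert _ D ⊆ ·)]
        rw [Finset.sum_comm]
        have : ∀ K ∈ 𝓑, (∑ x ∈ rem ∩ F, if insert x D ⊆ K then 1 else 0)
            ≤ if D ⊆ K then j + 1 else 0 := by
          intro K hK
          rw [← Finset.card_filter]
          split_ifs with hDK
          · have hsub : (rem ∩ F).filter (fun x => insert x D ⊆ K) ⊆ K \ D := by
              intro x hx
              rw [Finset.mem_filter, Finset.mem_inter] at hx
              exact Finset.mem_sdiff.mpr ⟨hx.2 (Finset.mem_insert_self _ _),
                fun hxD => Finset.disjoint_left.mp hdisj hxD hx.1.1⟩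
            have h1 := Finset.card_le_card hsub
            have h2 := Finset.card_sdiff_add_card_eq_card hDK
            have h3 := h𝓑 K hK
            omega
          · rw [Nat.le_zero, Finset.card_eq_zero, Finset.filter_eq_empty_iff]
            exact fun x _ h => hDK ((Finset.subset_insert _ _).trans h)
        refine (Finset.sum_le_sum this).trans (le_of_eq ?_)
        rw [← Finset.sum_filter, Finset.sum_const, smul_eq_mul]
      have h1 : ((rem ∩ F).card : ℝ) * N ^ j
          ≤ ∑ x ∈ rem ∩ F, (j.factorial : ℝ) * ((𝓑.filter (insert x D ⊆ ·)).card : ℝ) := by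
        rw [← nsmul_eq_mul]
        exact Finset.card_nsmul_le_sum _ _ _ hcon
      rw [← Finset.mul_sum] at h1
      have h2 : (∑ x ∈ rem ∩ F, ((𝓑.filter (insert x D ⊆ ·)).card : ℝ))
          ≤ ((𝓑.filter (D ⊆ ·)).card : ℝ) * (j + 1) := by exact_mod_cast hsum
      have h3 := mul_le_mul_of_nonneg_left h2 (Nat.cast_nonneg (α := ℝ) j.factorial)
      have h4 : N * N ^ j ≤ ((rem ∩ F).card : ℝ) * N ^ j := by
        refine mul_le_mul_of_nonneg_right ?_ (pow_nonneg hN j)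
        have : (0 : ℝ) ≤ 2 * ((j + 1 : ℕ) : ℝ) := by positivity
        linarith
      rw [pow_succ, Nat.factorial_succ] at hlt
      push_cast at hlt
      nlinarith
    obtain ⟨x, hx, hlt'⟩ := key
    rw [Finset.mem_inter] at hx
    refine WinsFrom.step hx.1 fun rem' hsub hcard => ?_
    have hxD : x ∉ D := fun h => Finset.disjoint_left.mp hdisj h hx.1
    refine ih rem' (insert x C) (insert x D) (hC.trans (Finset.subset_insert _ _)) ?_
      (Finset.insert_subset_insert _ hD) (Finset.insert_subset hx.2 hDF) ?_ ?_ ?_ hlt'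
    · exact Finset.insert_subset (Finset.mem_union_right _ hx.2) hC'
    · rw [Finset.disjoint_insert_left]
      exact ⟨fun h => Finset.notMem_erase _ _ (hsub h),
        hdisj.mono_right (hsub.trans (Finset.erase_subset _ _))⟩
    · rw [Finset.card_insert_of_notMem hxD]; omega
    · have hc := Finset.card_erase_add_one hx.1
      have h1 : (rem ∩ F) \ (rem' ∩ F) ⊆ rem \ rem' := by
        intro z hz
        simp only [Finset.mem_sdiff, Finset.mem_inter] at hz ⊢
        tauto
      have h2 := Finset.card_le_card h1
      have h3 := Finset.card_sdiff_add_card_eq_card (hsub.trans (Finset.erase_subset x rem))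
      have h4 := Finset.card_le_card_sdiff_add_card (s := rem ∩ F) (t := rem' ∩ F)
      have h5 : (rem ∩ F).card ≤ (rem' ∩ F).card + 2 := by omega
      have h6 : ((rem ∩ F).card : ℝ) ≤ (rem' ∩ F).card + 2 := by exact_mod_cast h5
      push_cast at hrem
      linarith

end Game

/-! ### Building a triangle and a branching structure -/

section Stages

variable {V : Type*} {W : Set (Finset (Sym2 V))}

/-- `C` contains a triangle with all vertices in `Q`. -/
def HasTriangleIn (Q : Finset V) (C : Finset (Sym2 V)) : Prop :=
  ∃ x ∈ Q, ∃ y ∈ Q, ∃ z ∈ Q, x ≠ y ∧ x ≠ z ∧ y ≠ z ∧ s(x, y) ∈ C ∧ s(x, z) ∈ C ∧ s(y, z) ∈ C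

lemma HasTriangleIn.wins_of_double {E : Finset (Sym2 V)} {Q : Finset V} {z o c w : V}
    (hz : z ∈ Q) (ho : o ∈ Q) (hc : c ∈ Q) (hw : w ∈ Q)
    (hzo : z ≠ o) (hzc : z ≠ c) (hzw : z ≠ w) (hoc : o ≠ c) (how : o ≠ w) (hcw : c ≠ w)
    (hpost : ∀ rem C, rem ⊆ E → C ⊆ E → E.card ≤ rem.card + 12 → HasTriangleIn Q C →
      WinsFrom W rem C)
    {rem C : Finset (Sym2 V)} (hrem : rem ⊆ E) (hC : C ⊆ E) (hcard : E.card ≤ rem.card + 8)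
    (h₁ : s(z, o) ∈ C) (h₂ : s(z, c) ∈ C)
    (hzwr : s(z, w) ∈ rem) (howr : s(o, w) ∈ rem) (hcwr : s(c, w) ∈ rem) :
    WinsFrom W rem C := by
  refine WinsFrom.threat hzwr howr (by simp only [ne_eq, Sym2.eq_iff]; grind only) ?_ ?_
  · intro rem' hsub hcard'
    refine hpost rem' _ (hsub.trans hrem) ?_ (by omega) ?_
    · exact Finset.insert_subset (hrem howr) (Finset.insert_subset (hrem hzwr) hC)
    · exact ⟨z, hz, o, ho, w, hw, hzo, hzw, how, by simp [h₁], by simp, by simp⟩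
  · intro rem' hsub hcard' hmem
    have hcw' : s(c, w) ∈ rem' := hmem _ hcwr
        (by simp only [ne_eq, Sym2.eq_iff]; grind only)
        (by simp only [ne_eq, Sym2.eq_iff]; grind only)
    refine WinsFrom.step hcw' fun rem'' hsub' hcard'' => ?_
    have := Finset.card_erase_add_one hcw'
    refine hpost rem'' _ ?_ ?_ (by omega) ?_
    · exact hsub'.trans ((Finset.erase_subset _ _).trans (hsub.trans hrem))
    · exact Finset.insert_subset (hrem hcwr) (Finset.insert_subset (hrem hzwr) hC)
    · exact ⟨z, hz, c, hc, w, hw, hzc, hzw, hcw, by simp [h₂], by simp, by simp⟩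

lemma HasTriangleIn.wins_of_center {E : Finset (Sym2 V)} {Q : Finset V} {z o c w : V}
    (hz : z ∈ Q) (ho : o ∈ Q) (hc : c ∈ Q) (hw : w ∈ Q)
    (hzo : z ≠ o) (hzc : z ≠ c) (hzw : z ≠ w) (hoc : o ≠ c) (how : o ≠ w) (hcw : c ≠ w)
    (hpost : ∀ rem C, rem ⊆ E → C ⊆ E → E.card ≤ rem.card + 12 → HasTriangleIn Q C →
      WinsFrom W rem C)
    {rem C : Finset (Sym2 V)} (hrem : rem ⊆ E) (hC : C ⊆ E) (hcard : E.card ≤ rem.card + 6)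
    (h₁ : s(z, o) ∈ C) (hzcr : s(z, c) ∈ rem) (hocr : s(o, c) ∈ rem)
    (hzwr : s(z, w) ∈ rem) (howr : s(o, w) ∈ rem) (hcwr : s(c, w) ∈ rem) :
    WinsFrom W rem C := by
  refine WinsFrom.threat hzcr hocr (by simp only [ne_eq, Sym2.eq_iff]; grind only) ?_ ?_
  · intro rem' hsub hcard'
    refine hpost rem' _ (hsub.trans hrem) ?_ (by omega) ?_
    · exact Finset.insert_subset (hrem hocr) (Finset.insert_subset (hrem hzcr) hC)
    · exact ⟨z, hz, o, ho, c, hc, hzo, hzc, hoc, by simp [h₁], by simp, by simp⟩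
  · intro rem' hsub hcard' hmem
    exact wins_of_double hz ho hc hw hzo hzc hzw hoc how hcw hpost (hsub.trans hrem)
      (Finset.insert_subset (hrem hzcr) hC) (by omega) (by simp [h₁]) (by simp)
      (hmem _ hzwr
          (by simp only [ne_eq, Sym2.eq_iff]; grind only)
          (by simp only [ne_eq, Sym2.eq_iff]; grind only))
      (hmem _ howr
          (by simp only [ne_eq, Sym2.eq_iff]; grind only)
          (by simp only [ne_eq, Sym2.eq_iff]; grind only))
      (hmem _ hcwr
          (by simp only [ne_eq, Sym2.eq_iff]; grind only)
          (by simp only [ne_eq, Sym2.eq_iff]; grind only))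

lemma HasTriangleIn.wins_of_first_edge {E : Finset (Sym2 V)} {Q : Finset V} {z o c u v : V}
    (hz : z ∈ Q) (ho : o ∈ Q) (hc : c ∈ Q) (hu : u ∈ Q) (hv : v ∈ Q)
    (hzo : z ≠ o) (hzc : z ≠ c) (hzu : z ≠ u) (hzv : z ≠ v) (hoc : o ≠ c) (hou : o ≠ u)
    (hov : o ≠ v) (hcu : c ≠ u) (hcv : c ≠ v) (huv : u ≠ v)
    (hpost : ∀ rem C, rem ⊆ E → C ⊆ E → E.card ≤ rem.card + 12 → HasTriangleIn Q C →
      WinsFrom W rem C)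
    {rem C : Finset (Sym2 V)} (hrem : rem ⊆ E) (hC : C ⊆ E) (hcard : E.card ≤ rem.card + 2)
    (h₁ : s(z, o) ∈ C) (hzcr : s(z, c) ∈ rem) (hzur : s(z, u) ∈ rem) (hzvr : s(z, v) ∈ rem)
    (f : Sym2 V) (hocr : s(o, c) ≠ f → s(o, c) ∈ rem) (hour : s(o, u) ≠ f → s(o, u) ∈ rem)
    (hovr : s(o, v) ≠ f → s(o, v) ∈ rem) (hcur : s(c, u) ≠ f → s(c, u) ∈ rem)
    (hcvr : s(c, v) ≠ f → s(c, v) ∈ rem) :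
    WinsFrom W rem C := by
  by_cases h : f = s(o, c)
  · subst h
    have hour' := hour (by simp only [ne_eq, Sym2.eq_iff]; grind only)
    have hovr' := hovr (by simp only [ne_eq, Sym2.eq_iff]; grind only)
    have hcur' := hcur (by simp only [ne_eq, Sym2.eq_iff]; grind only)
    have hcvr' := hcvr (by simp only [ne_eq, Sym2.eq_iff]; grind only)
    refine WinsFrom.threat hzur hour' (by simp only [ne_eq, Sym2.eq_iff]; grind only) ?_ ?_
    · intro rem' hsub hcard'
      refine hpost rem' _ (hsub.trans hrem) ?_ (by omega) ?_
      · exact Finset.insert_subset (hrem hour') (Finset.insert_subset (hrem hzur) hC)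
      · exact ⟨z, hz, o, ho, u, hu, hzo, hzu, hou, by simp [h₁], by simp, by simp⟩
    · intro rem' hsub hcard' hmem
      have hzcr' := hmem _ hzcr
          (by simp only [ne_eq, Sym2.eq_iff]; grind only)
          (by simp only [ne_eq, Sym2.eq_iff]; grind only)
      have hzvr' := hmem _ hzvr
          (by simp only [ne_eq, Sym2.eq_iff]; grind only)
          (by simp only [ne_eq, Sym2.eq_iff]; grind only)
      have hcu' := hmem _ hcur'
          (by simp only [ne_eq, Sym2.eq_iff]; grind only)
          (by simp only [ne_eq, Sym2.eq_iff]; grind only)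
      have hcv' := hmem _ hcvr'
          (by simp only [ne_eq, Sym2.eq_iff]; grind only)
          (by simp only [ne_eq, Sym2.eq_iff]; grind only)
      have hov' := hmem _ hovr'
          (by simp only [ne_eq, Sym2.eq_iff]; grind only)
          (by simp only [ne_eq, Sym2.eq_iff]; grind only)
      have hC' : insert s(z, u) C ⊆ E := Finset.insert_subset (hrem hzur) hC
      refine WinsFrom.threat hzcr' hcu' (by simp only [ne_eq, Sym2.eq_iff]; grind only) ?_ ?_
      · intro rem'' hsub' hcard''
        refine hpost rem'' _ (hsub'.trans (hsub.trans hrem)) ?_ (by omega) ?_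
        · exact Finset.insert_subset (hrem hcur') (Finset.insert_subset (hrem hzcr) hC')
        · exact ⟨z, hz, c, hc, u, hu, hzc, hzu, hcu, by simp, by simp, by simp⟩
      · intro rem'' hsub' hcard'' hmem'
        exact wins_of_double hz ho hc hv hzo hzc hzv hoc hov hcv hpost
          (hsub'.trans (hsub.trans hrem)) (Finset.insert_subset (hrem hzcr) hC') (by omega)
          (by simp [h₁]) (by simp)
          (hmem' _ hzvr'
              (by simp only [ne_eq, Sym2.eq_iff]; grind only)
              (by simp only [ne_eq, Sym2.eq_iff]; grind only))
          (hmem' _ hov'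
              (by simp only [ne_eq, Sym2.eq_iff]; grind only)
              (by simp only [ne_eq, Sym2.eq_iff]; grind only))
          (hmem' _ hcv'
              (by simp only [ne_eq, Sym2.eq_iff]; grind only)
              (by simp only [ne_eq, Sym2.eq_iff]; grind only))
  · have hocr' := hocr (Ne.symm h)
    by_cases h' : f = s(o, u) ∨ f = s(c, u)
    · refine wins_of_center hz ho hc hv hzo hzc hzv hoc hov hcv hpost hrem hC (by omega)
        h₁ hzcr hocr' hzvr (hovr ?_) (hcvr ?_)
      all_goals rcases h' with rfl | rfl <;> (simp only [ne_eq, Sym2.eq_iff]; grind only)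
    · push Not at h'
      exact wins_of_center hz ho hc hu hzo hzc hzu hoc hou hcu hpost hrem hC (by omega)
        h₁ hzcr hocr' hzur (hour h'.1.symm) (hcur h'.2.symm)

/-- Playing first on a `K₅` minus an edge, Maker claims a triangle. -/
lemma HasTriangleIn.wins {E : Finset (Sym2 V)} {Q : Finset V} {a b c u v : V}
    (ha : a ∈ Q) (hb : b ∈ Q) (hc : c ∈ Q) (hu : u ∈ Q) (hv : v ∈ Q)
    (hab : a ≠ b) (hac : a ≠ c) (hau : a ≠ u) (hav : a ≠ v) (hbc : b ≠ c) (hbu : b ≠ u)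
    (hbv : b ≠ v) (hcu : c ≠ u) (hcv : c ≠ v) (huv : u ≠ v)
    (hpost : ∀ rem C, rem ⊆ E → C ⊆ E → E.card ≤ rem.card + 12 → HasTriangleIn Q C →
      WinsFrom W rem C)
    (eab : s(a, b) ∈ E) (eac : s(a, c) ∈ E) (eau : s(a, u) ∈ E) (eav : s(a, v) ∈ E)
    (ebc : s(b, c) ∈ E) (ebu : s(b, u) ∈ E) (ebv : s(b, v) ∈ E) (ecu : s(c, u) ∈ E)
    (ecv : s(c, v) ∈ E) :
    WinsFrom W E ∅ := by
  refine WinsFrom.step eab fun rem hsub hcard => ?_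
  have hcE := Finset.card_erase_add_one eab
  have hrem : rem ⊆ E := hsub.trans (Finset.erase_subset _ _)
  have hC : insert s(a, b) (∅ : Finset (Sym2 V)) ⊆ E := Finset.insert_subset eab (by simp)
  obtain ⟨f, hf⟩ : ∃ f, ∀ e ∈ E, e ≠ s(a, b) → e ≠ f → e ∈ rem := by
    have h1 := Finset.card_sdiff_add_card_eq_card hsub
    have h2 : (E.erase s(a, b) \ rem).card ≤ 1 := by omega
    have : Nonempty (Sym2 V) := ⟨s(a, b)⟩
    obtain ⟨f, hf⟩ := Finset.card_le_one_iff_subset_singleton.mp h2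
    refine ⟨f, fun e he hne hef => ?_⟩
    by_contra hcon
    exact hef (Finset.mem_singleton.mp
      (hf (Finset.mem_sdiff.mpr ⟨Finset.mem_erase.mpr ⟨hne, he⟩, hcon⟩)))
  by_cases h : f = s(b, c) ∨ f = s(b, u) ∨ f = s(b, v)
  · refine wins_of_first_edge ha hb hc hu hv hab hac hau hav hbc hbu hbv hcu hcv huv hpost hrem hC
      (by omega) (by simp) (hf _ eac ?_ ?_) (hf _ eau ?_ ?_) (hf _ eav ?_ ?_) f (hf _ ebc ?_)
      (hf _ ebu ?_) (hf _ ebv ?_) (hf _ ecu ?_) (hf _ ecv ?_)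
    all_goals first
      | (simp only [ne_eq, Sym2.eq_iff]; grind only)
      | (rcases h with rfl | rfl | rfl <;> (simp only [ne_eq, Sym2.eq_iff]; grind only))
  · push Not at h
    refine wins_of_first_edge hb ha hc hu hv hab.symm hbc hbu hbv hac hau hav hcu hcv huv hpost
      hrem hC (by omega) (by simp [Sym2.eq_swap]) (hf _ ebc ?_ h.1.symm) (hf _ ebu ?_ h.2.1.symm)
      (hf _ ebv ?_ h.2.2.symm) f (hf _ eac ?_) (hf _ eau ?_) (hf _ eav ?_) (hf _ ecu ?_)
      (hf _ ecv ?_)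
    all_goals (simp only [ne_eq, Sym2.eq_iff]; grind only)

/-- The pairs with one vertex in `A` and the other one outside `R`. -/
def cutPairs [Fintype V] (A R : Finset V) : Finset (Sym2 V) :=
  (A ×ˢ Rᶜ).image fun x => s(x.1, x.2)

lemma card_cutPairs [Fintype V] {A R : Finset V} (h : A ⊆ R) :
    (cutPairs A R).card = A.card * (Fintype.card V - R.card) := by
  rw [cutPairs, Finset.card_image_of_injOn, Finset.card_product, Finset.card_compl]
  rintro ⟨a, b⟩ hab ⟨c, d⟩ hcd heq
  simp only [Finset.coe_product, Set.mem_prod, Finset.mem_coe, Finset.mem_compl] at hab hcd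
  simp only [Sym2.eq_iff] at heq
  rcases heq with ⟨rfl, rfl⟩ | ⟨rfl, rfl⟩
  · rfl
  · exact absurd (h hab.1) hcd.2

lemma cutPairs_anti [Fintype V] {A R R' : Finset V} (h : R ⊆ R') :
    cutPairs A R' ⊆ cutPairs A R :=
  Finset.image_subset_image (Finset.product_subset_product_right (Finset.compl_subset_compl.mpr h))

/-- If there are always many edges leaving `A`, then Maker can connect `A` to many new vertices. -/
lemma WinsFrom.grow [Fintype V] {E : Finset (Sym2 V)} {A R₀ : Finset V} {L a : ℕ}
    (hcut : ∀ R, R₀ ⊆ R → R.card ≤ R₀.card + a → L + 2 * a < (E ∩ cutPairs A R).card)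
    (C₀ : Finset (Sym2 V))
    (hpost : ∀ rem C, rem ⊆ E → C ⊆ E → C₀ ⊆ C → E.card ≤ rem.card + (L + 2 * a) →
      ∀ A' : Finset V, A'.card = a → Disjoint A' R₀ → (∀ v ∈ A', ∃ u ∈ A, s(u, v) ∈ C) →
      WinsFrom W rem C) (j : ℕ) :
    ∀ rem C, rem ⊆ E → C ⊆ E → C₀ ⊆ C → ∀ A' : Finset V, A'.card + j = a →
      E.card ≤ rem.card + (L + 2 * A'.card) → Disjoint A' R₀ →
      (∀ v ∈ A', ∃ u ∈ A, s(u, v) ∈ C) → WinsFrom W rem C := by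
  induction j with
  | zero =>
    intro rem C hrem hC hC₀ A' hA' hcard hdisj hadj
    simp only [add_zero] at hA'
    exact hpost rem C hrem hC hC₀ (by rw [← hA']; exact hcard) A' hA' hdisj hadj
  | succ j ih =>
    intro rem C hrem hC hC₀ A' hA' hcard hdisj hadj
    have h1 := hcut (R₀ ∪ A') Finset.subset_union_left
      ((Finset.card_union_le _ _).trans (by omega))
    obtain ⟨e, he, her⟩ : ∃ e ∈ E ∩ cutPairs A (R₀ ∪ A'), e ∈ rem := by
      by_contra! hcon
      have hsub : E ∩ cutPairs A (R₀ ∪ A') ⊆ E \ rem := fun e he =>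
        Finset.mem_sdiff.mpr ⟨(Finset.mem_inter.mp he).1, hcon e he⟩
      have h2 := Finset.card_le_card hsub
      have h3 := Finset.card_sdiff_add_card_eq_card hrem
      omega
    have he' := (Finset.mem_inter.mp he).2
    simp only [cutPairs, Finset.mem_image, Finset.mem_product, Finset.mem_compl, Finset.mem_union,
      not_or, Prod.exists] at he'
    obtain ⟨u, v, ⟨hu, hvR, hvA⟩, rfl⟩ := he'
    refine WinsFrom.step her fun rem' hsub hcard' => ?_
    have hc := Finset.card_erase_add_one her
    refine ih rem' _ (hsub.trans ((Finset.erase_subset _ _).trans hrem))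
      (Finset.insert_subset (hrem her) hC) (hC₀.trans (Finset.subset_insert _ _)) (insert v A')
      ?_ ?_ ?_ ?_
    · rw [Finset.card_insert_of_notMem hvA]; omega
    · rw [Finset.card_insert_of_notMem hvA]; omega
    · exact Finset.disjoint_insert_left.mpr ⟨hvR, hdisj⟩
    · intro w hw
      rcases Finset.mem_insert.mp hw with rfl | hw
      · exact ⟨u, hu, Finset.mem_insert_self _ _⟩
      · obtain ⟨u', hu', h'⟩ := hadj w hw
        exact ⟨u', hu', Finset.mem_insert_of_mem h'⟩

end Stages

/-! ### Random subsets with independent elements -/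

section RandomSubset

variable [DecidableEq X]

section Contained

variable {ι : Type*} (I : Finset ι) (A : ι → Finset X)

/-- The number of members of the family contained in `R`. -/
def containedCount (R : Finset X) : ℕ := (I.filter fun i => A i ⊆ R).card

lemma containedCount_mono {R S : Finset X} (h : R ⊆ S) :
    containedCount I A R ≤ containedCount I A S :=
  Finset.card_le_card (Finset.monotone_filter_right _ fun _ _ hi => hi.trans h)

lemma exp_neg_containedCount_antitone {s : ℝ} (hs : 0 ≤ s) (B : Finset X) :
    Antitone fun R => Real.exp (-s * containedCount I A (R ∪ B)) := by
  intro R S h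
  have : (containedCount I A (R ∪ B) : ℝ) ≤ containedCount I A (S ∪ B) := by
    exact_mod_cast containedCount_mono I A (Finset.union_subset_union_left h)
  exact Real.exp_le_exp.mpr (by nlinarith)

end Contained

variable [Fintype X]

/-- The probability of the outcome `R` for the random subset of `X` containing each `x` with
probability `π x`, independently. -/
def subsetWeight (π : X → ℝ) (R : Finset X) : ℝ := ∏ x, if x ∈ R then π x else 1 - π x

/-- The expectation of a function of the random subset. -/
def subsetEx (π : X → ℝ) (F : Finset X → ℝ) : ℝ := ∑ R, subsetWeight π R * F R

/-- The probability of an event about the random subset. -/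
def subsetPr (π : X → ℝ) (P : Finset X → Prop) : ℝ := subsetEx π fun R => if P R then 1 else 0

variable {π : X → ℝ}

lemma subsetWeight_nonneg (h0 : ∀ x, 0 ≤ π x) (h1 : ∀ x, π x ≤ 1) (R : Finset X) :
    0 ≤ subsetWeight π R :=
  Finset.prod_nonneg fun x _ => by
    split_ifs
    · exact h0 x
    · linarith [h1 x]

lemma subsetWeight_mul (R S : Finset X) :
    subsetWeight π R * subsetWeight π S = subsetWeight π (R ∩ S) * subsetWeight π (R ∪ S) := by
  simp only [subsetWeight, ← Finset.prod_mul_distrib, Finset.mem_inter, Finset.mem_union]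
  refine Finset.prod_congr rfl fun x _ => ?_
  by_cases h : x ∈ R <;> by_cases h' : x ∈ S <;> simp [h, h', mul_comm]

lemma sum_subsetWeight : ∑ R, subsetWeight π R = 1 := by
  have h := Finset.prod_add π (fun x => 1 - π x) Finset.univ
  simp only [add_sub_cancel, Finset.prod_const_one, Finset.powerset_univ] at h
  rw [h]
  refine Finset.sum_congr rfl fun R _ => ?_
  rw [subsetWeight, Finset.prod_ite]
  congr 2
  · ext; simp
  · ext; simp

lemma subsetEx_const (c : ℝ) : subsetEx π (fun _ => c) = c := by
  rw [subsetEx, ← Finset.sum_mul, sum_subsetWeight, one_mul]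

lemma subsetEx_mono (h0 : ∀ x, 0 ≤ π x) (h1 : ∀ x, π x ≤ 1) {F G : Finset X → ℝ}
    (h : ∀ R, F R ≤ G R) : subsetEx π F ≤ subsetEx π G :=
  Finset.sum_le_sum fun R _ => mul_le_mul_of_nonneg_left (h R) (subsetWeight_nonneg h0 h1 R)

lemma subsetEx_sum {ι : Type*} (I : Finset ι) (F : ι → Finset X → ℝ) :
    subsetEx π (fun R => ∑ i ∈ I, F i R) = ∑ i ∈ I, subsetEx π (F i) := by
  simp only [subsetEx, Finset.mul_sum]
  exact Finset.sum_comm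

lemma subsetEx_sub (F G : Finset X → ℝ) :
    subsetEx π (fun R => F R - G R) = subsetEx π F - subsetEx π G := by
  simp only [subsetEx, mul_sub, Finset.sum_sub_distrib]

lemma subsetEx_const_mul (c : ℝ) (F : Finset X → ℝ) :
    subsetEx π (fun R => c * F R) = c * subsetEx π F := by
  simp only [subsetEx, Finset.mul_sum]
  exact Finset.sum_congr rfl fun R _ => by ring

lemma subsetEx_mem (x : X) (F : Finset X → ℝ) :
    subsetEx π (fun R => if x ∈ R then F R else 0) = π x * subsetEx π fun R => F (insert x R) := by
  have hu : (Finset.univ : Finset (Finset X)) = (insert x (Finset.univ.erase x)).powerset := by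
    simp
  have hx : x ∉ (Finset.univ.erase x : Finset X) := by simp
  have key : ∀ R ∈ (Finset.univ.erase x : Finset X).powerset,
      subsetWeight π (insert x R) = π x * ∏ y ∈ Finset.univ.erase x,
        (if y ∈ R then π y else 1 - π y) ∧
      subsetWeight π R = (1 - π x) * ∏ y ∈ Finset.univ.erase x,
        (if y ∈ R then π y else 1 - π y) := by
    intro R hR
    have hxR : x ∉ R := fun h => hx (Finset.mem_powerset.mp hR h)
    simp only [subsetWeight]
    rw [← Finset.mul_prod_erase _ _ (Finset.mem_univ x),
      ← Finset.mul_prod_erase _ _ (Finset.mem_univ x)]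
    refine ⟨?_, by simp [hxR]⟩
    congr 1
    · simp
    · refine Finset.prod_congr rfl fun y hy => ?_
      simp [Finset.ne_of_mem_erase hy]
  simp only [subsetEx]
  rw [hu, Finset.sum_powerset_insert hx, Finset.sum_powerset_insert hx, ← Finset.sum_add_distrib,
    ← Finset.sum_add_distrib, Finset.mul_sum]
  refine Finset.sum_congr rfl fun R hR => ?_
  obtain ⟨e1, e2⟩ := key R hR
  have hxR : x ∉ R := fun h => hx (Finset.mem_powerset.mp hR h)
  rw [e1, e2]
  simp only [hxR, if_false, Finset.mem_insert_self, if_true, Finset.insert_idem]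
  ring

lemma subsetEx_superset (A : Finset X) : ∀ F : Finset X → ℝ,
    subsetEx π (fun R => if A ⊆ R then F R else 0) =
      (∏ x ∈ A, π x) * subsetEx π fun R => F (R ∪ A) := by
  induction A using Finset.induction_on with
  | empty => intro F; simp
  | insert x A hx ih =>
    intro F
    have h : (fun R : Finset X => if insert x A ⊆ R then F R else 0) =
        fun R => if x ∈ R then (if A ⊆ R then F R else 0) else 0 := by
      funext R
      simp only [Finset.insert_subset_iff]
      by_cases h : x ∈ R <;> simp [h]
    rw [h, subsetEx_mem, Finset.prod_insert hx]
    have h' : (fun R : Finset X => if A ⊆ insert x R then F (insert x R) else 0) =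
        fun R => if A ⊆ R then F (insert x R) else 0 := by
      funext R
      congr 1
      rw [Finset.subset_insert_iff_of_notMem hx]
    rw [h', ih (fun R => F (insert x R)), mul_assoc]
    congr 2
    simp only [Finset.union_insert]

lemma subsetEx_ite_superset (A : Finset X) :
    subsetEx π (fun R => if A ⊆ R then 1 else 0) = ∏ x ∈ A, π x := by
  rw [subsetEx_superset A fun _ => 1, subsetEx_const, mul_one]

lemma subsetPr_le_one (h0 : ∀ x, 0 ≤ π x) (h1 : ∀ x, π x ≤ 1) (P : Finset X → Prop) :
    subsetPr π P ≤ 1 := by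
  rw [← subsetEx_const (π := π) 1]
  exact subsetEx_mono h0 h1 fun R => by split_ifs <;> norm_num

lemma subsetPr_mono (h0 : ∀ x, 0 ≤ π x) (h1 : ∀ x, π x ≤ 1) {P Q : Finset X → Prop}
    (h : ∀ R, P R → Q R) : subsetPr π P ≤ subsetPr π Q :=
  subsetEx_mono h0 h1 fun R => by
    by_cases hP : P R
    · simp [hP, h R hP]
    · simp only [hP, if_false]; split_ifs <;> norm_num

lemma subsetPr_or_le (h0 : ∀ x, 0 ≤ π x) (h1 : ∀ x, π x ≤ 1) (P Q : Finset X → Prop) :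
    subsetPr π (fun R => P R ∨ Q R) ≤ subsetPr π P + subsetPr π Q := by
  simp only [subsetPr, subsetEx, ← Finset.sum_add_distrib, ← mul_add]
  refine Finset.sum_le_sum fun R _ =>
    mul_le_mul_of_nonneg_left ?_ (subsetWeight_nonneg h0 h1 R)
  by_cases hP : P R <;> by_cases hQ : Q R <;> simp [hP, hQ]

lemma subsetPr_exists_le (h0 : ∀ x, 0 ≤ π x) (h1 : ∀ x, π x ≤ 1) {ι : Type*} (I : Finset ι)
    (P : ι → Finset X → Prop) :
    subsetPr π (fun R => ∃ i ∈ I, P i R) ≤ ∑ i ∈ I, subsetPr π (P i) := by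
  simp only [subsetPr]
  rw [← subsetEx_sum]
  refine subsetEx_mono h0 h1 fun R => ?_
  split_ifs with h
  · obtain ⟨i, hi, hP⟩ := h
    refine le_trans (by simp [hP]) (Finset.single_le_sum
      (f := fun i => if P i R then (1 : ℝ) else 0)
      (fun j _ => by split_ifs <;> norm_num) hi)
  · exact Finset.sum_nonneg fun j _ => by split_ifs <;> norm_num

/-- Markov's inequality. -/
lemma subsetPr_le_div (h0 : ∀ x, 0 ≤ π x) (h1 : ∀ x, π x ≤ 1) {F : Finset X → ℝ}
    (hF : ∀ R, 0 ≤ F R) {a : ℝ} (ha : 0 < a) :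
    subsetPr π (fun R => a ≤ F R) ≤ subsetEx π F / a := by
  rw [le_div_iff₀ ha, mul_comm, subsetPr, ← subsetEx_const_mul]
  refine subsetEx_mono h0 h1 fun R => ?_
  split_ifs with h
  · simpa using h
  · simpa using hF R

/-- Harris' inequality for two decreasing functions. -/
lemma subsetEx_mul_le (h0 : ∀ x, 0 ≤ π x) (h1 : ∀ x, π x ≤ 1) {F G : Finset X → ℝ}
    (hF₀ : ∀ R, 0 ≤ F R) (hG₀ : ∀ R, 0 ≤ G R) (hF : Antitone F) (hG : Antitone G) :
    subsetEx π F * subsetEx π G ≤ subsetEx π fun R => F R * G R := by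
  have h := fkg (α := (Finset X)ᵒᵈ) (μ := fun R => subsetWeight π (OrderDual.ofDual R))
    (f := fun R => F (OrderDual.ofDual R)) (g := fun R => G (OrderDual.ofDual R))
    (fun R => subsetWeight_nonneg h0 h1 _) (fun R => hF₀ _) (fun R => hG₀ _)
    (fun a b hab => hF hab) (fun a b hab => hG hab)
    (fun a b => by
      rw [subsetWeight_mul, mul_comm]
      exact le_of_eq rfl)
  have hs : ∑ a : (Finset X)ᵒᵈ, subsetWeight π (OrderDual.ofDual a) = 1 := sum_subsetWeight
  rw [hs, one_mul] at h
  exact h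

section Janson

variable {ι : Type*} (I : Finset ι) (A : ι → Finset X)

variable (π) in
/-- The sum over intersecting ordered pairs of the probability that both are contained. -/
def jansonDelta : ℝ :=
  ∑ i ∈ I, ∑ j ∈ I.filter (fun j => ¬ Disjoint (A j) (A i)), ∏ x ∈ A i ∪ A j, π x

lemma le_subsetEx_contained (h0 : ∀ x, 0 ≤ π x) (h1 : ∀ x, π x ≤ 1) {s : ℝ} (hs : 0 ≤ s)
    (i : ι) :
    (∏ x ∈ A i, π x -
      s * ∑ j ∈ I.filter (fun j => ¬ Disjoint (A j) (A i)), ∏ x ∈ A i ∪ A j, π x) *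
      subsetEx π (fun R => Real.exp (-s * containedCount I A R)) ≤
    subsetEx π fun R => if A i ⊆ R then Real.exp (-s * containedCount I A R) else 0 := by
  set J := I.filter (fun j => ¬ Disjoint (A j) (A i))
  set K := I.filter (fun j => Disjoint (A j) (A i))
  have hsplit : ∀ R, containedCount I A (R ∪ A i) =
      containedCount J A (R ∪ A i) + containedCount K A R := by
    intro R
    have hK : containedCount K A R = containedCount K A (R ∪ A i) := by
      unfold containedCount
      congr 1
      refine Finset.filter_congr fun j hj => ?_
      have hd := (Finset.mem_filter.mp hj).2
      refine ⟨fun h => h.trans Finset.subset_union_left, fun h x hx => ?_⟩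
      rcases Finset.mem_union.mp (h hx) with h' | h'
      · exact h'
      · exact absurd h' (Finset.disjoint_left.mp hd hx)
    rw [hK]
    unfold containedCount
    rw [add_comm, ← Finset.card_filter_add_card_filter_not (s := I.filter _)
      (fun j => Disjoint (A j) (A i))]
    congr 2 <;> rw [Finset.filter_comm]
  have hprod : 0 ≤ ∏ x ∈ A i, π x := Finset.prod_nonneg fun x _ => h0 x
  have hY : (∏ x ∈ A i, π x) * subsetEx π (fun R => (containedCount J A (R ∪ A i) : ℝ)) =
      ∑ j ∈ J, ∏ x ∈ A i ∪ A j, π x := by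
    rw [← subsetEx_superset (A i) (fun R => (containedCount J A R : ℝ))]
    rw [show (fun R => if A i ⊆ R then (containedCount J A R : ℝ) else 0) =
      fun R => ∑ j ∈ J, if A i ∪ A j ⊆ R then (1 : ℝ) else 0 from ?_, subsetEx_sum]
    · exact Finset.sum_congr rfl fun j _ => subsetEx_ite_superset _
    · funext R
      by_cases h : A i ⊆ R <;> simp [containedCount, Finset.union_subset_iff, h]
  rw [subsetEx_superset]
  have hΨ0 : 0 ≤ subsetEx π (fun R => Real.exp (-s * containedCount I A R)) := by
    rw [← subsetEx_const (π := π) 0]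
    exact subsetEx_mono h0 h1 fun R => (Real.exp_pos _).le
  have hharris := subsetEx_mul_le h0 h1
    (F := fun R => Real.exp (-s * containedCount J A (R ∪ A i)))
    (G := fun R => Real.exp (-s * containedCount K A (R ∪ ∅)))
    (fun R => (Real.exp_pos _).le) (fun R => (Real.exp_pos _).le)
    (exp_neg_containedCount_antitone J A hs _) (exp_neg_containedCount_antitone K A hs _)
  have hZ : subsetEx π (fun R => Real.exp (-s * containedCount I A R)) ≤
      subsetEx π (fun R => Real.exp (-s * containedCount K A (R ∪ ∅))) := by
    refine subsetEx_mono h0 h1 fun R => Real.exp_le_exp.mpr ?_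
    have : (containedCount K A (R ∪ ∅) : ℝ) ≤ containedCount I A R := by
      rw [Finset.union_empty]
      exact_mod_cast Finset.card_le_card
        (Finset.filter_subset_filter _ (Finset.filter_subset _ _))
    nlinarith
  have hlow : 1 - s * subsetEx π (fun R => (containedCount J A (R ∪ A i) : ℝ)) ≤
      subsetEx π (fun R => Real.exp (-s * containedCount J A (R ∪ A i))) := by
    rw [← subsetEx_const_mul, ← subsetEx_const (π := π) 1, ← subsetEx_sub]
    refine subsetEx_mono h0 h1 fun R => ?_
    have := Real.add_one_le_exp (-s * (containedCount J A (R ∪ A i) : ℝ))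
    linarith
  have hexp0 : 0 ≤ subsetEx π (fun R => Real.exp (-s * containedCount J A (R ∪ A i))) := by
    rw [← subsetEx_const (π := π) 0]
    exact subsetEx_mono h0 h1 fun R => (Real.exp_pos _).le
  have heq : (fun R => Real.exp (-s * containedCount I A (R ∪ A i))) = fun R =>
      Real.exp (-s * containedCount J A (R ∪ A i)) *
        Real.exp (-s * containedCount K A (R ∪ ∅)) := by
    funext R
    rw [← Real.exp_add, hsplit, Finset.union_empty]
    congr 1
    push_cast
    ring
  rw [heq, ← hY]
  calc _ = (∏ x ∈ A i, π x) *
        ((1 - s * subsetEx π (fun R => (containedCount J A (R ∪ A i) : ℝ))) *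
          subsetEx π (fun R => Real.exp (-s * containedCount I A R))) := by ring
    _ ≤ _ := by
        refine mul_le_mul_of_nonneg_left ?_ hprod
        refine le_trans ?_ hharris
        exact (mul_le_mul_of_nonneg_right hlow hΨ0).trans (mul_le_mul_of_nonneg_left hZ hexp0)

/-- Janson's bound for the moment generating function. -/
lemma subsetEx_exp_neg_containedCount_le (h0 : ∀ x, 0 ≤ π x) (h1 : ∀ x, π x ≤ 1) {s : ℝ}
    (hs : 0 ≤ s) :
    subsetEx π (fun R => Real.exp (-s * containedCount I A R)) ≤
      Real.exp (-(s * ∑ i ∈ I, ∏ x ∈ A i, π x) + s ^ 2 * jansonDelta π I A / 2) := by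
  set μ := ∑ i ∈ I, ∏ x ∈ A i, π x
  set Δ := jansonDelta π I A
  set Ψ : ℝ → ℝ := fun s => subsetEx π (fun R => Real.exp (-s * containedCount I A R)) with hΨ
  have hderiv : ∀ s, HasDerivAt Ψ
      (-subsetEx π (fun R => containedCount I A R * Real.exp (-s * containedCount I A R))) s := by
    intro s
    simp only [hΨ, subsetEx]
    rw [← Finset.sum_neg_distrib]
    refine HasDerivAt.fun_sum fun R _ => ?_
    have h := (((hasDerivAt_neg s).mul_const (containedCount I A R : ℝ)).exp).const_mul
      (subsetWeight π R)
    refine h.congr_deriv ?_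
    ring
  have hlow : ∀ s, 0 ≤ s → (μ - s * Δ) * Ψ s ≤
      subsetEx π (fun R => containedCount I A R * Real.exp (-s * containedCount I A R)) := by
    intro s hs
    have e1 : (fun R => (containedCount I A R : ℝ) * Real.exp (-s * containedCount I A R)) =
        fun R => ∑ i ∈ I, if A i ⊆ R then Real.exp (-s * containedCount I A R) else 0 := by
      funext R
      rw [← Finset.sum_filter, Finset.sum_const, nsmul_eq_mul]
      rfl
    rw [e1, subsetEx_sum]
    refine le_trans (le_of_eq ?_)
      (Finset.sum_le_sum fun i _ => le_subsetEx_contained I A h0 h1 hs i)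
    rw [← Finset.sum_mul, Finset.sum_sub_distrib, ← Finset.mul_sum]
    rfl
  have hE : ∀ s : ℝ, HasDerivAt (fun s : ℝ => Real.exp (s * μ - s ^ 2 * Δ / 2))
      (Real.exp (s * μ - s ^ 2 * Δ / 2) * (μ - s * Δ)) s := by
    intro s
    have h := (((hasDerivAt_id s).mul_const μ).sub
      ((((hasDerivAt_id s).pow 2).mul_const Δ).div_const 2)).exp
    refine h.congr_deriv ?_
    simp
    ring
  have hd : ∀ s, HasDerivAt (fun s => Ψ s * Real.exp (s * μ - s ^ 2 * Δ / 2)) _ s :=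
    fun s => (hderiv s).mul (hE s)
  have hanti : AntitoneOn (fun s => Ψ s * Real.exp (s * μ - s ^ 2 * Δ / 2)) (Set.Ici 0) := by
    refine antitoneOn_of_deriv_nonpos (convex_Ici 0)
      (fun s _ => (hd s).continuousAt.continuousWithinAt)
      (fun s _ => (hd s).differentiableAt.differentiableWithinAt) fun s hs => ?_
    rw [interior_Ici] at hs
    rw [(hd s).deriv]
    have h2 := hlow s (le_of_lt hs)
    have h3 := Real.exp_pos (s * μ - s ^ 2 * Δ / 2)
    nlinarith
  have h := hanti (Set.mem_Ici.mpr le_rfl) (Set.mem_Ici.mpr hs) hs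
  have hΨ0 : Ψ 0 = 1 := by simp [hΨ, subsetEx_const]
  simp only [hΨ0, zero_mul, one_mul] at h
  norm_num at h
  have h4 : Ψ s ≤ Real.exp (-(s * μ - s ^ 2 * Δ / 2)) := by
    rw [Real.exp_neg, ← one_div, le_div_iff₀ (Real.exp_pos _)]
    exact h
  refine h4.trans (le_of_eq ?_)
  congr 1
  ring

/-- Janson's inequality. -/
lemma subsetPr_containedCount_eq_zero_le (h0 : ∀ x, 0 ≤ π x) (h1 : ∀ x, π x ≤ 1) {Δ : ℝ}
    (hΔ : jansonDelta π I A ≤ Δ) (hΔ0 : 0 < Δ) :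
    subsetPr π (fun R => ∀ i ∈ I, ¬ A i ⊆ R) ≤
      Real.exp (-((∑ i ∈ I, ∏ x ∈ A i, π x) ^ 2 / (2 * Δ))) := by
  set μ := ∑ i ∈ I, ∏ x ∈ A i, π x with hμ
  have hμ0 : 0 ≤ μ := Finset.sum_nonneg fun i _ => Finset.prod_nonneg fun x _ => h0 x
  have h := subsetEx_exp_neg_containedCount_le I A h0 h1 (div_nonneg hμ0 hΔ0.le)
  rw [← hμ] at h
  refine le_trans (subsetEx_mono h0 h1 fun R => ?_) (h.trans (Real.exp_le_exp.mpr ?_))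
  · split_ifs with hR
    · have : containedCount I A R = 0 := by
        rw [containedCount, Finset.card_eq_zero, Finset.filter_eq_empty_iff]
        exact fun i hi => hR i hi
      simp [this]
    · exact (Real.exp_pos _).le
  · have h2 : (μ / Δ) ^ 2 * jansonDelta π I A ≤ (μ / Δ) ^ 2 * Δ :=
      mul_le_mul_of_nonneg_left hΔ (sq_nonneg _)
    have h3 : (μ / Δ) ^ 2 * Δ = μ ^ 2 / Δ := by field_simp
    have h4 : μ / Δ * μ = μ ^ 2 / Δ := by ring
    have h5 : μ ^ 2 / (2 * Δ) = μ ^ 2 / Δ / 2 := by field_simp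
    rw [h4, h5]
    linarith

/-- Chernoff's bound for the lower tail. -/
lemma subsetPr_card_inter_le (h0 : ∀ x, 0 ≤ π x) (h1 : ∀ x, π x ≤ 1) (E : Finset X) {η : ℝ}
    (hη : 0 ≤ η) :
    subsetPr π (fun R => ((R ∩ E).card : ℝ) ≤ (1 - η) * ∑ x ∈ E, π x) ≤
      Real.exp (-(η ^ 2 / 2 * ∑ x ∈ E, π x)) := by
  have h := subsetEx_exp_neg_containedCount_le E (fun x => ({x} : Finset X)) h0 h1 hη
  have hΔ : jansonDelta π E (fun x => ({x} : Finset X)) = ∑ x ∈ E, π x := by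
    refine Finset.sum_congr rfl fun x hx => ?_
    rw [show E.filter (fun j => ¬ Disjoint ({j} : Finset X) {x}) = {x} from ?_]
    · simp
    · ext y
      simp only [Finset.mem_filter, Finset.disjoint_singleton, not_not, Finset.mem_singleton]
      exact ⟨fun h => h.2, fun h => ⟨h ▸ hx, h⟩⟩
  have hcount : ∀ R : Finset X, containedCount E (fun x => ({x} : Finset X)) R = (R ∩ E).card := by
    intro R
    unfold containedCount
    congr 1
    ext y
    simp [and_comm]
  simp only [hΔ, hcount, Finset.prod_singleton] at h
  set μ := ∑ x ∈ E, π x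
  have h2 : subsetPr π (fun R => ((R ∩ E).card : ℝ) ≤ (1 - η) * μ) ≤
      Real.exp (η * ((1 - η) * μ)) * subsetEx π (fun R => Real.exp (-η * ((R ∩ E).card : ℝ))) := by
    rw [← subsetEx_const_mul]
    refine subsetEx_mono h0 h1 fun R => ?_
    rw [← Real.exp_add]
    split_ifs with hR
    · exact Real.one_le_exp (by nlinarith)
    · exact (Real.exp_pos _).le
  refine h2.trans ((mul_le_mul_of_nonneg_left h (Real.exp_pos _).le).trans (le_of_eq ?_))
  rw [← Real.exp_add]
  congr 1
  ring

end Janson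

end RandomSubset

/-! ### Random copies of a fixed graph -/

section Copies

variable {V : Type*}

/-- The image of a set of pairs under an embedding. -/
def imageEdges (Ed : Finset (Sym2 β)) {S : Finset V} (f : β ↪ S) : Finset (Sym2 V) :=
  Ed.image (Sym2.map fun b => (f b : V))

lemma sym2Map_injective {S : Finset V} (f : β ↪ S) :
    Function.Injective (Sym2.map fun b => (f b : V)) :=
  Sym2.map.injective (Subtype.val_injective.comp f.injective)

lemma card_imageEdges (Ed : Finset (Sym2 β)) {S : Finset V} (f : β ↪ S) :
    (imageEdges Ed f).card = Ed.card :=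
  Finset.card_image_of_injective _ (sym2Map_injective f)

lemma imageEdges_inside {Ed : Finset (Sym2 β)} (hEd : ∀ e ∈ Ed, ¬ e.IsDiag) {S : Finset V}
    (f : β ↪ S) : ∀ e ∈ imageEdges Ed f, ¬ e.IsDiag ∧ ∀ x ∈ e, x ∈ S := by
  intro e he
  obtain ⟨d, hd, rfl⟩ := Finset.mem_image.mp he
  refine ⟨?_, fun x hx => ?_⟩
  · have := hEd d hd
    induction d with
    | _ a b =>
      simp only [Sym2.map_mk, Sym2.mk_isDiag_iff] at this ⊢
      exact fun h => this (f.injective (Subtype.ext h))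
  · obtain ⟨b, -, rfl⟩ := Sym2.mem_map.mp hx
    exact (f b).2

variable [Fintype β]

lemma sum_pow_card_le {S : Finset V} (f : β ↪ S) :
    ∑ g : β ↪ S, (S.card : ℝ) ^ (Finset.univ.filter fun b => g b ∈ Set.range f).card ≤
      (((Fintype.card β : ℝ) + 1) * S.card) ^ Fintype.card β := by
  have hterm : ∀ g : β → S, (S.card : ℝ) ^ (Finset.univ.filter fun b => g b ∈ Set.range f).card =
      ∏ b, if g b ∈ Set.range f then (S.card : ℝ) else 1 := by
    intro g
    rw [Finset.prod_ite]
    simp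
  calc ∑ g : β ↪ S, (S.card : ℝ) ^ (Finset.univ.filter fun b => g b ∈ Set.range f).card
      ≤ ∑ g : β → S, ∏ b, (if g b ∈ Set.range f then (S.card : ℝ) else 1) := by
        refine (Finset.sum_map (Finset.univ : Finset (β ↪ S))
          ⟨DFunLike.coe, DFunLike.coe_injective⟩
          (fun g : β → S => (S.card : ℝ) ^
            (Finset.univ.filter fun b => g b ∈ Set.range f).card)).symm.le.trans ?_
        simp only [hterm]
        refine Finset.sum_le_sum_of_subset_of_nonneg (Finset.subset_univ _) fun g _ _ =>
          Finset.prod_nonneg fun b _ => ?_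
        split_ifs <;> positivity
    _ = (∑ y : S, if y ∈ Set.range f then (S.card : ℝ) else 1) ^ Fintype.card β := by
        have h := Finset.prod_univ_sum (fun _ : β => (Finset.univ : Finset S))
          (fun _ y => if y ∈ Set.range f then (S.card : ℝ) else 1)
        rw [Fintype.piFinset_univ] at h
        rw [← h]
        simp
    _ ≤ _ := by
        refine pow_le_pow_left₀ (Finset.sum_nonneg fun y _ => by split_ifs <;> positivity) ?_ _
        have hy : ∀ y : S, (if y ∈ Set.range f then (S.card : ℝ) else 1) ≤
            (if y ∈ Finset.univ.image f then (S.card : ℝ) else 0) + 1 := by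
          intro y
          by_cases h : y ∈ Set.range f
          · have h' : y ∈ Finset.univ.image f := by
              obtain ⟨b, rfl⟩ := h
              simp
            simp [h, h']
          · simp only [h, if_false]
            split_ifs
            · linarith [Nat.cast_nonneg (α := ℝ) S.card]
            · linarith
        refine (Finset.sum_le_sum fun y _ => hy y).trans (le_of_eq ?_)
        rw [Finset.sum_add_distrib, Finset.sum_ite_mem, Finset.univ_inter, Finset.sum_const,
          Finset.card_image_of_injective _ f.injective]
        simp
        ring

variable [Fintype V]

/-- Janson's inequality for copies of a fixed graph inside a vertex set. -/
lemma subsetPr_no_copy_le {Ed : Finset (Sym2 β)} (hEd : ∀ e ∈ Ed, ¬ e.IsDiag) {S : Finset V}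
    {π : Sym2 V → ℝ} (h0 : ∀ x, 0 ≤ π x) (h1 : ∀ x, π x ≤ 1) {q Φ : ℝ} (hq : 0 < q) (hΦ : 0 < Φ)
    (hS : 2 * Fintype.card β ≤ S.card) (hS0 : 0 < S.card)
    (hπ : ∀ e : Sym2 V, ¬ e.IsDiag → (∀ x ∈ e, x ∈ S) → π e = q)
    (hd : ∀ T : Finset β, ∀ D ⊆ Ed, D.Nonempty → (∀ e ∈ D, ∀ x ∈ e, x ∈ T) →
      Φ ≤ (S.card : ℝ) ^ T.card * q ^ D.card) :
    subsetPr π (fun R => ∀ f : β ↪ S, ¬ imageEdges Ed f ⊆ R) ≤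
      Real.exp (-(Φ / (2 * (4 * ((Fintype.card β : ℝ) + 1)) ^ Fintype.card β))) := by
  set v := Fintype.card β with hv
  set s : ℝ := (S.card : ℝ) with hs
  have hs0 : 0 < s := by rw [hs]; exact_mod_cast hS0
  set Δ : ℝ := s ^ v * ((((v : ℝ) + 1) * s) ^ v * q ^ (2 * Ed.card) / Φ) with hΔdef
  have hΔ0 : 0 < Δ := by positivity
  have hprod : ∀ B : Finset (Sym2 V), (∀ e ∈ B, ¬ e.IsDiag ∧ ∀ x ∈ e, x ∈ S) →
      ∏ e ∈ B, π e = q ^ B.card := by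
    intro B hB
    rw [Finset.prod_congr rfl fun e he => hπ e (hB e he).1 (hB e he).2, Finset.prod_const]
  have hpair : ∀ f g : β ↪ S, ¬ Disjoint (imageEdges Ed g) (imageEdges Ed f) →
      ∏ e ∈ imageEdges Ed f ∪ imageEdges Ed g, π e ≤
        s ^ (Finset.univ.filter fun b => g b ∈ Set.range f).card * (q ^ (2 * Ed.card) / Φ) := by
    intro f g hfg
    rw [hprod _ fun e he => (Finset.mem_union.mp he).elim (imageEdges_inside hEd f e)
      (imageEdges_inside hEd g e)]
    set D := Ed.filter fun d => Sym2.map (fun b => (g b : V)) d ∈ imageEdges Ed f with hD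
    have hDi : imageEdges Ed f ∩ imageEdges Ed g = D.image (Sym2.map fun b => (g b : V)) := by
      ext e
      simp only [hD, imageEdges, Finset.mem_inter, Finset.mem_image, Finset.mem_filter]
      constructor
      · rintro ⟨h, d, hd, rfl⟩
        exact ⟨d, ⟨hd, h⟩, rfl⟩
      · rintro ⟨d, ⟨hd, h⟩, rfl⟩
        exact ⟨h, d, hd, rfl⟩
    have hDcard : (imageEdges Ed f ∩ imageEdges Ed g).card = D.card := by
      rw [hDi, Finset.card_image_of_injective _ (sym2Map_injective g)]
    have hDne : D.Nonempty := by
      rw [← Finset.card_pos, ← hDcard, Finset.card_pos]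
      rw [Finset.not_disjoint_iff] at hfg
      obtain ⟨e, he1, he2⟩ := hfg
      exact ⟨e, Finset.mem_inter.mpr ⟨he2, he1⟩⟩
    have hΦ' := hd (Finset.univ.filter fun b => g b ∈ Set.range f) D (Finset.filter_subset _ _)
      hDne (by
        intro d hd x hx
        have hmem := (Finset.mem_filter.mp hd).2
        obtain ⟨d', -, hd'⟩ := Finset.mem_image.mp hmem
        have hx' : (g x : V) ∈ Sym2.map (fun b => (g b : V)) d := Sym2.mem_map.mpr ⟨x, hx, rfl⟩
        rw [← hd'] at hx'
        obtain ⟨y, -, hy⟩ := Sym2.mem_map.mp hx'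
        simp only [Finset.mem_filter, Finset.mem_univ, true_and]
        exact ⟨y, Subtype.ext hy⟩)
    have hcard : (imageEdges Ed f ∪ imageEdges Ed g).card + D.card = 2 * Ed.card := by
      rw [← hDcard, Finset.card_union_add_card_inter, card_imageEdges, card_imageEdges, two_mul]
    have hqD : 0 < q ^ D.card := pow_pos hq _
    rw [← mul_div_assoc, le_div_iff₀ hΦ]
    calc q ^ (imageEdges Ed f ∪ imageEdges Ed g).card * Φ
        ≤ q ^ (imageEdges Ed f ∪ imageEdges Ed g).card *
          (s ^ (Finset.univ.filter fun b => g b ∈ Set.range f).card * q ^ D.card) :=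
          mul_le_mul_of_nonneg_left hΦ' (pow_pos hq _).le
      _ = _ := by rw [← hcard, pow_add]; ring
  have hΔ : jansonDelta π Finset.univ (fun f : β ↪ S => imageEdges Ed f) ≤ Δ := by
    calc jansonDelta π Finset.univ (fun f : β ↪ S => imageEdges Ed f)
        ≤ ∑ f : β ↪ S, ∑ g : β ↪ S,
          s ^ (Finset.univ.filter fun b => g b ∈ Set.range f).card * (q ^ (2 * Ed.card) / Φ) := by
          refine Finset.sum_le_sum fun f _ => ?_
          refine (Finset.sum_le_sum fun g hg => hpair f g (Finset.mem_filter.mp hg).2).trans ?_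
          refine Finset.sum_le_sum_of_subset_of_nonneg (Finset.filter_subset _ _) fun g _ _ => ?_
          positivity
      _ ≤ ∑ f : β ↪ S, (((v : ℝ) + 1) * s) ^ v * q ^ (2 * Ed.card) / Φ := by
          refine Finset.sum_le_sum fun f _ => ?_
          rw [← Finset.sum_mul, mul_div_assoc]
          exact mul_le_mul_of_nonneg_right (sum_pow_card_le f) (by positivity)
      _ ≤ Δ := by
          rw [Finset.sum_const, nsmul_eq_mul, hΔdef, Finset.card_univ, Fintype.card_embedding_eq]
          refine mul_le_mul_of_nonneg_right ?_ (by positivity)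
          rw [Fintype.card_coe, hs]
          exact_mod_cast Nat.descFactorial_le_pow _ _
  have hμ : (s / 2) ^ v * q ^ Ed.card ≤ ∑ f : β ↪ S, ∏ e ∈ imageEdges Ed f, π e := by
    rw [Finset.sum_congr rfl fun f _ => hprod _ (imageEdges_inside hEd f)]
    simp only [card_imageEdges, Finset.sum_const, nsmul_eq_mul, Finset.card_univ,
      Fintype.card_embedding_eq, Fintype.card_coe]
    refine mul_le_mul_of_nonneg_right ?_ (by positivity)
    have h := Nat.pow_sub_le_descFactorial S.card v
    have h' : (((S.card + 1 - v : ℕ) : ℝ)) ^ v ≤ (S.card.descFactorial v : ℝ) := by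
      exact_mod_cast h
    refine le_trans (pow_le_pow_left₀ (by positivity) ?_ _) h'
    rw [div_le_iff₀ (by norm_num)]
    have : S.card ≤ (S.card + 1 - v) * 2 := by omega
    rw [hs]
    exact_mod_cast this
  have hJ := subsetPr_containedCount_eq_zero_le Finset.univ (fun f : β ↪ S => imageEdges Ed f)
    h0 h1 hΔ hΔ0
  simp only [Finset.mem_univ, forall_const] at hJ
  refine hJ.trans (Real.exp_le_exp.mpr (neg_le_neg ?_))
  rw [le_div_iff₀ (by positivity)]
  have hμ2 := pow_le_pow_left₀ (by positivity) hμ 2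
  refine le_trans (le_of_eq ?_) hμ2
  rw [hΔdef]
  have h2 : (4 : ℝ) ^ v = 2 ^ v * 2 ^ v := by rw [← mul_pow]; norm_num
  rw [mul_pow, mul_pow, div_pow, h2]
  field_simp
  ring

end Copies

/-! ### Counting sets of edges without a copy -/

section Counting

lemma factorial_le_exp_mul (k : ℕ) :
    ((k + 1).factorial : ℝ) ≤
      Real.exp 1 * (k + 1) * (((k : ℝ) + 1) / Real.exp 1) ^ (k + 1) := by
  induction k with
  | zero =>
    simp
  | succ k ih =>
    have he := Real.exp_pos 1
    have hk : (0 : ℝ) < (k : ℝ) + 1 := by positivity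
    have hk2 : (0 : ℝ) < (k : ℝ) + 2 := by positivity
    have hlog : Real.exp 1 * ((k : ℝ) + 1) ^ (k + 2) ≤ ((k : ℝ) + 2) ^ (k + 2) := by
      have h1 : Real.exp 1 ≤ (((k : ℝ) + 2) / (k + 1)) ^ (k + 2) := by
        rw [← Real.exp_log (show 0 < ((k : ℝ) + 2) / (k + 1) by positivity), ← Real.exp_nat_mul]
        refine Real.exp_le_exp.mpr ?_
        have h2 := Real.one_sub_inv_le_log_of_pos (show 0 < ((k : ℝ) + 2) / (k + 1) by positivity)
        have h3 : 1 - (((k : ℝ) + 2) / (k + 1))⁻¹ = 1 / (k + 2) := by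
          field_simp
          ring
        rw [h3, div_le_iff₀ hk2] at h2
        push_cast
        linarith
      rw [div_pow, le_div_iff₀ (by positivity)] at h1
      exact h1
    have hfac : (((k + 1 + 1).factorial : ℕ) : ℝ) = ((k : ℝ) + 2) * ((k + 1).factorial : ℝ) := by
      rw [Nat.factorial_succ (k + 1)]
      push_cast
      ring
    rw [hfac]
    push_cast
    have hcast : (k : ℝ) + 1 + 1 = k + 2 := by ring
    rw [hcast]
    calc ((k : ℝ) + 2) * ((k + 1).factorial : ℝ)
        ≤ ((k : ℝ) + 2) * (Real.exp 1 * (k + 1) * (((k : ℝ) + 1) / Real.exp 1) ^ (k + 1)) :=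
          mul_le_mul_of_nonneg_left ih hk2.le
      _ = ((k : ℝ) + 2) * (Real.exp 1 * ((k : ℝ) + 1) ^ (k + 2)) / Real.exp 1 ^ (k + 1) := by
          rw [div_pow]
          ring
      _ ≤ ((k : ℝ) + 2) * ((k : ℝ) + 2) ^ (k + 2) / Real.exp 1 ^ (k + 1) := by
          gcongr
      _ = _ := by
          rw [div_pow, pow_succ (Real.exp 1) (k + 1)]
          field_simp

lemma exp_neg_le_one_sub_pow {N k : ℕ} (hk : k < N) :
    Real.exp (-(k : ℝ)) ≤ (1 - (k : ℝ) / N) ^ (N - k) := by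
  have hN : (0 : ℝ) < N := by exact_mod_cast (Nat.zero_le k).trans_lt hk
  have hkN : (k : ℝ) < N := by exact_mod_cast hk
  have h0 : 0 < 1 - (k : ℝ) / N := by
    rw [sub_pos, div_lt_one hN]
    exact hkN
  rw [← Real.exp_log h0, ← Real.exp_nat_mul]
  refine Real.exp_le_exp.mpr ?_
  have h1 := Real.one_sub_inv_le_log_of_pos h0
  have h2 : 1 - (1 - (k : ℝ) / N)⁻¹ = -(k : ℝ) / (N - k) := by
    have : (N : ℝ) - k ≠ 0 := by linarith
    have : 1 - (k : ℝ) / N = (N - k) / N := by field_simp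
    rw [this, inv_div]
    field_simp
    ring
  rw [h2, div_le_iff₀ (by linarith)] at h1
  rw [Nat.cast_sub hk.le]
  linarith

variable {V : Type*} [Fintype V]

/-- The pairs of distinct vertices of `S`. -/
def insidePairs (S : Finset V) : Finset (Sym2 V) :=
  Finset.univ.filter fun e => ¬ e.IsDiag ∧ ∀ x ∈ e, x ∈ S

lemma mem_insidePairs {S : Finset V} {e : Sym2 V} :
    e ∈ insidePairs S ↔ ¬ e.IsDiag ∧ ∀ x ∈ e, x ∈ S := by
  simp [insidePairs]

lemma card_insidePairs (S : Finset V) : (insidePairs S).card = S.card.choose 2 := by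
  rw [← Sym2.card_image_offDiag]
  congr 1
  ext e
  induction e with
  | _ a b =>
    simp only [mem_insidePairs, Sym2.mk_isDiag_iff, Sym2.mem_iff, forall_eq_or_imp, forall_eq,
      Finset.mem_image, Finset.mem_offDiag, Prod.exists]
    constructor
    · rintro ⟨h, ha, hb⟩
      exact ⟨a, b, ⟨ha, hb, h⟩, rfl⟩
    · rintro ⟨c, d, ⟨hc, hd, hne⟩, heq⟩
      rcases Sym2.eq_iff.mp heq with ⟨rfl, rfl⟩ | ⟨rfl, rfl⟩
      · exact ⟨hne, hc, hd⟩
      · exact ⟨hne.symm, hd, hc⟩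

variable [Fintype β]

/-- The sets of `k` pairs inside `S` that contain no copy. -/
def copyFreeSets (Ed : Finset (Sym2 β)) (S : Finset V) (k : ℕ) : Finset (Finset (Sym2 V)) :=
  ((insidePairs S).powersetCard k).filter fun K => ∀ f : β ↪ S, ¬ imageEdges Ed f ⊆ K

lemma subsetWeight_inside {S : Finset V} {K : Finset (Sym2 V)} (hK : K ⊆ insidePairs S) (q : ℝ) :
    subsetWeight (fun e => if e ∈ insidePairs S then q else 0) K =
      q ^ K.card * (1 - q) ^ ((insidePairs S).card - K.card) := by
  have h : ∀ e : Sym2 V, (if e ∈ K then (if e ∈ insidePairs S then q else 0)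
      else 1 - (if e ∈ insidePairs S then q else 0)) =
      (if e ∈ K then q else 1) * (if e ∈ insidePairs S \ K then 1 - q else 1) := by
    intro e
    by_cases h1 : e ∈ K
    · simp [h1, hK h1]
    · by_cases h2 : e ∈ insidePairs S <;> simp [h1, h2]
  rw [subsetWeight, Finset.prod_congr rfl fun e _ => h e, Finset.prod_mul_distrib]
  simp only [Finset.prod_ite_mem, Finset.univ_inter, Finset.prod_const,
    Finset.card_sdiff_of_subset hK]

/-- The constant in the exponent of the bound on the number of copy-free sets. -/
def copyConst (β : Type*) [Fintype β] : ℝ :=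
  1 / (2 * (4 * ((Fintype.card β : ℝ) + 1)) ^ Fintype.card β)

lemma copyConst_pos : 0 < copyConst β := by
  unfold copyConst
  positivity

lemma factorial_mul_card_copyFreeSets_le {Ed : Finset (Sym2 β)} (hEd : ∀ e ∈ Ed, ¬ e.IsDiag)
    {S : Finset V} {k : ℕ} (hk : 0 < k) (hkN : k < (insidePairs S).card)
    (hS : 2 * Fintype.card β ≤ S.card)
    (hd : ∀ T : Finset β, ∀ D ⊆ Ed, D.Nonempty → (∀ e ∈ D, ∀ x ∈ e, x ∈ T) →
      (S.card : ℝ) ^ 2 * (k / (insidePairs S).card) ≤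
        (S.card : ℝ) ^ T.card * ((k : ℝ) / (insidePairs S).card) ^ D.card) :
    (k.factorial : ℝ) * (copyFreeSets Ed S k).card ≤
      Real.exp 1 * k * Real.exp (-(2 * copyConst β * k)) * ((insidePairs S).card : ℝ) ^ k := by
  set N := (insidePairs S).card with hN
  have hN0 : (0 : ℝ) < N := by exact_mod_cast hk.trans hkN
  have hk0 : (0 : ℝ) < k := by exact_mod_cast hk
  have hkN' : (k : ℝ) < N := by exact_mod_cast hkN
  set q : ℝ := k / N with hq
  have hq0 : 0 < q := div_pos hk0 hN0
  have hq1 : q < 1 := (div_lt_one hN0).mpr hkN'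
  have hNS : N = S.card.choose 2 := card_insidePairs S
  have hS0 : 0 < S.card := by
    rcases Nat.eq_zero_or_pos S.card with h | h
    · rw [h] at hNS
      simp at hNS
      omega
    · exact h
  have hS0' : (0 : ℝ) < S.card := by exact_mod_cast hS0
  have hN2 : 2 * (N : ℝ) ≤ (S.card : ℝ) ^ 2 := by
    rw [hNS, Nat.cast_choose_two]
    nlinarith
  set π : Sym2 V → ℝ := fun e => if e ∈ insidePairs S then q else 0 with hπ
  have h0 : ∀ e, 0 ≤ π e := fun e => by
    simp only [hπ]
    split_ifs
    · exact hq0.le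
    · exact le_rfl
  have h1 : ∀ e, π e ≤ 1 := fun e => by
    simp only [hπ]
    split_ifs
    · exact hq1.le
    · exact zero_le_one
  have hP := subsetPr_no_copy_le hEd h0 h1 hq0 (Φ := (S.card : ℝ) ^ 2 * q) (by positivity) hS hS0
    (fun e he hx => by simp [hπ, mem_insidePairs, he]; exact fun x hxe hxS => absurd (hx x hxe) hxS)
    hd
  have hlow : ((copyFreeSets Ed S k).card : ℝ) * (q ^ k * (1 - q) ^ (N - k)) ≤
      subsetPr π (fun R => ∀ f : β ↪ S, ¬ imageEdges Ed f ⊆ R) := by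
    rw [← nsmul_eq_mul, ← Finset.sum_const]
    refine le_trans (Finset.sum_le_sum fun K hK => ?_)
      (Finset.sum_le_sum_of_subset_of_nonneg (Finset.subset_univ (copyFreeSets Ed S k))
        fun K _ _ => ?_)
    · obtain ⟨hK1, hK2⟩ := Finset.mem_filter.mp hK
      obtain ⟨hK3, hK4⟩ := Finset.mem_powersetCard.mp hK1
      dsimp only
      rw [if_pos hK2, mul_one, hπ, subsetWeight_inside hK3, hK4]
    · exact mul_nonneg (subsetWeight_nonneg h0 h1 K) (by dsimp only; split_ifs <;> norm_num)
  have hexp : Real.exp (-((S.card : ℝ) ^ 2 * q /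
      (2 * (4 * ((Fintype.card β : ℝ) + 1)) ^ Fintype.card β))) ≤
      Real.exp (-(2 * copyConst β * k)) := by
    refine Real.exp_le_exp.mpr (neg_le_neg ?_)
    have hc := copyConst_pos (β := β)
    have : (S.card : ℝ) ^ 2 * q / (2 * (4 * ((Fintype.card β : ℝ) + 1)) ^ Fintype.card β) =
        copyConst β * ((S.card : ℝ) ^ 2 * q) := by
      unfold copyConst
      ring
    rw [this]
    have h2 : 2 * (k : ℝ) ≤ (S.card : ℝ) ^ 2 * q := by
      calc 2 * (k : ℝ) = 2 * N * q := by rw [hq]; field_simp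
        _ ≤ _ := mul_le_mul_of_nonneg_right hN2 hq0.le
    nlinarith
  have h1q := exp_neg_le_one_sub_pow hkN
  have hfac : (k.factorial : ℝ) ≤ Real.exp 1 * k * ((k : ℝ) / Real.exp 1) ^ k := by
    obtain ⟨m, rfl⟩ : ∃ m, k = m + 1 := ⟨k - 1, by omega⟩
    have := factorial_le_exp_mul m
    push_cast
    exact this
  have hqk : 0 < q ^ k * Real.exp (-(k : ℝ)) := mul_pos (pow_pos hq0 _) (Real.exp_pos _)
  have hcard : ((copyFreeSets Ed S k).card : ℝ) * (q ^ k * Real.exp (-(k : ℝ))) ≤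
      Real.exp (-(2 * copyConst β * k)) := by
    refine le_trans ?_ (hlow.trans (hP.trans hexp))
    exact mul_le_mul_of_nonneg_left (mul_le_mul_of_nonneg_left h1q (pow_pos hq0 _).le)
      (Nat.cast_nonneg _)
  have hek : ((k : ℝ) / Real.exp 1) ^ k = (N : ℝ) ^ k * (q ^ k * Real.exp (-(k : ℝ))) := by
    rw [div_pow, ← Real.exp_nat_mul, mul_one, ← mul_assoc, ← mul_pow, Real.exp_neg,
      ← div_eq_mul_inv]
    congr 2
    rw [hq]
    field_simp
  calc (k.factorial : ℝ) * (copyFreeSets Ed S k).card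
      ≤ (Real.exp 1 * k * ((k : ℝ) / Real.exp 1) ^ k) * (copyFreeSets Ed S k).card :=
        mul_le_mul_of_nonneg_right hfac (Nat.cast_nonneg _)
    _ = Real.exp 1 * k * (N : ℝ) ^ k *
        ((copyFreeSets Ed S k).card * (q ^ k * Real.exp (-(k : ℝ)))) := by
        rw [hek]; ring
    _ ≤ Real.exp 1 * k * (N : ℝ) ^ k * Real.exp (-(2 * copyConst β * k)) :=
        mul_le_mul_of_nonneg_left hcard (by positivity)
    _ = _ := by ring

/-- A random set of pairs contains few copy-free sets. -/
lemma subsetPr_many_copyFreeSets_le {Ed : Finset (Sym2 β)} (hEd : ∀ e ∈ Ed, ¬ e.IsDiag)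
    {S : Finset V} {k : ℕ} (hk : 0 < k) (hkN : k < (insidePairs S).card)
    (hS : 2 * Fintype.card β ≤ S.card)
    (hd : ∀ T : Finset β, ∀ D ⊆ Ed, D.Nonempty → (∀ e ∈ D, ∀ x ∈ e, x ∈ T) →
      (S.card : ℝ) ^ 2 * (k / (insidePairs S).card) ≤
        (S.card : ℝ) ^ T.card * ((k : ℝ) / (insidePairs S).card) ^ D.card)
    {π : Sym2 V → ℝ} (h0 : ∀ x, 0 ≤ π x) (h1 : ∀ x, π x ≤ 1) {p : ℝ} (hp : 0 < p)
    (hπ : ∀ e ∈ insidePairs S, π e = p) {M : ℕ}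
    (hM : Real.exp (-copyConst β) * (p * (insidePairs S).card) ≤ M) :
    subsetPr π (fun R => M ^ k ≤
        k.factorial * ((copyFreeSets Ed S k).filter fun K => K ⊆ R).card) ≤
      Real.exp 1 * k * Real.exp (-(copyConst β * k)) := by
  set N := (insidePairs S).card with hN
  have hN0 : (0 : ℝ) < N := by exact_mod_cast hk.trans hkN
  have hM0 : (0 : ℝ) < M := lt_of_lt_of_le (by positivity) hM
  have hmarkov := subsetPr_le_div h0 h1
    (F := fun R => (k.factorial : ℝ) * ((copyFreeSets Ed S k).filter fun K => K ⊆ R).card)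
    (fun R => by positivity) (pow_pos hM0 k)
  have hex : subsetEx π (fun R => (k.factorial : ℝ) *
      ((copyFreeSets Ed S k).filter fun K => K ⊆ R).card) =
      k.factorial * (copyFreeSets Ed S k).card * p ^ k := by
    rw [subsetEx_const_mul, mul_assoc]
    congr 1
    have : (fun R : Finset (Sym2 V) => (((copyFreeSets Ed S k).filter fun K => K ⊆ R).card : ℝ)) =
        fun R => ∑ K ∈ copyFreeSets Ed S k, if K ⊆ R then (1 : ℝ) else 0 := by
      funext R
      simp
    rw [this, subsetEx_sum, ← nsmul_eq_mul, ← Finset.sum_const]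
    refine Finset.sum_congr rfl fun K hK => ?_
    obtain ⟨hK3, hK4⟩ := Finset.mem_powersetCard.mp (Finset.mem_filter.mp hK).1
    rw [subsetEx_ite_superset, Finset.prod_congr rfl fun e he => hπ e (hK3 he), Finset.prod_const,
      hK4]
  have hmono : subsetPr π (fun R => M ^ k ≤
        k.factorial * ((copyFreeSets Ed S k).filter fun K => K ⊆ R).card) ≤
      subsetPr π (fun R => (M : ℝ) ^ k ≤
        (k.factorial : ℝ) * ((copyFreeSets Ed S k).filter fun K => K ⊆ R).card) :=
    subsetPr_mono h0 h1 fun R hR => by exact_mod_cast hR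
  refine hmono.trans (hmarkov.trans ?_)
  rw [hex, div_le_iff₀ (pow_pos hM0 k)]
  have hcount := factorial_mul_card_copyFreeSets_le hEd hk hkN hS hd
  have hMk := pow_le_pow_left₀ (by positivity) hM k
  have hsplit : Real.exp (-(2 * copyConst β * k)) * (p * N) ^ k =
      Real.exp (-(copyConst β * k)) * (Real.exp (-copyConst β) * (p * N)) ^ k := by
    rw [mul_pow (Real.exp _), ← Real.exp_nat_mul, ← mul_assoc, ← Real.exp_add]
    congr 2
    ring
  calc (k.factorial : ℝ) * (copyFreeSets Ed S k).card * p ^ k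
      ≤ Real.exp 1 * k * Real.exp (-(2 * copyConst β * k)) * (N : ℝ) ^ k * p ^ k :=
        mul_le_mul_of_nonneg_right hcount (by positivity)
    _ = Real.exp 1 * k * (Real.exp (-(2 * copyConst β * k)) * (p * N) ^ k) := by
        rw [mul_pow]; ring
    _ = Real.exp 1 * k * Real.exp (-(copyConst β * k)) *
        (Real.exp (-copyConst β) * (p * N)) ^ k := by rw [hsplit]; ring
    _ ≤ _ := mul_le_mul_of_nonneg_left hMk (by positivity)

end Counting

/-! ### Graphs on which Maker wins the `H_P`-game -/

section Deterministic

/-- The edges of `K₅` minus an edge. -/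
def nearK5 : Finset (Sym2 (Fin 5)) :=
  {s(0, 1), s(0, 2), s(0, 3), s(0, 4), s(1, 2), s(1, 3), s(1, 4), s(2, 3), s(2, 4)}

variable {V : Type*} [Fintype β]

lemma exists_mem_copyFinsets_HP {H : SimpleGraph β} {v₀ : β} {G : SimpleGraph V}
    {C : Finset (Sym2 V)} (hC : ∀ e ∈ C, e ∈ G.edgeSet) {S : Finset V} (f : β ↪ S)
    (hf : imageEdges H.edgeFinset f ⊆ C) {x y z a b : V} (hxy : x ≠ y) (hxz : x ≠ z) (hxa : x ≠ a)
    (hxb : x ≠ b) (hyz : y ≠ z) (hya : y ≠ a) (hyb : y ≠ b) (hza : z ≠ a) (hzb : z ≠ b)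
    (hab : a ≠ b) (hx : x ∉ S) (hy : y ∉ S) (hz : z ∉ S) (ha : a ∉ S) (hb : b ∉ S)
    (exy : s(x, y) ∈ C) (exz : s(x, z) ∈ C) (eyz : s(y, z) ∈ C) (exa : s(x, a) ∈ C)
    (eab : s(a, b) ∈ C) (eb : s(b, (f v₀ : V)) ∈ C) :
    ∃ A ∈ copyFinsets (HP H v₀) G, A ⊆ C := by
  have hinj : Function.Injective (![x, y, z, a, b] : Fin 5 → V) := by
    intro i j hij
    fin_cases i <;> fin_cases j <;> first
      | rfl
      | exact absurd hij (by assumption)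
      | exact absurd hij.symm (by assumption)
  have hnot : ∀ i, (![x, y, z, a, b] : Fin 5 → V) i ∉ S := by
    intro i
    fin_cases i <;> assumption
  let g : β ⊕ Fin 5 ↪ V := ⟨Sum.elim (fun c => (f c : V)) ![x, y, z, a, b],
    Function.Injective.sumElim (Subtype.val_injective.comp f.injective) hinj
      fun c i h => hnot i (h ▸ (f c).2)⟩
  have key : ∀ e ∈ (HP H v₀).edgeSet, Sym2.map g e ∈ C := by
    intro e he
    simp only [HP, SimpleGraph.edgeSet_fromEdgeSet] at he
    rcases he.1 with ⟨d, hd, rfl⟩ | h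
    · refine hf (Finset.mem_image.mpr ⟨d, by simpa using hd, ?_⟩)
      rw [Sym2.map_map]
      rfl
    · simp only [Set.mem_insert_iff, Set.mem_singleton_iff] at h
      rcases h with rfl | rfl | rfl | rfl | rfl | rfl
      · exact exy
      · exact exz
      · exact eyz
      · exact exa
      · exact eab
      · exact eb
  refine ⟨(HP H v₀).edgeSet.toFinset.image (Sym2.map g), ⟨g, fun u v huv => ?_, by simp⟩, ?_⟩
  · exact hC _ (key s(u, v) huv)
  · intro e he
    obtain ⟨d, hd, rfl⟩ := Finset.mem_image.mp he
    exact key d (by simpa using hd)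

variable [Fintype V]

/-- There are many edges between any small set `A` and the complement of any set `R ⊇ A` that is
not too large. -/
def ManyCutEdges (r : ℕ) (E : Finset (Sym2 V)) : Prop :=
  ∀ i < 3, ∀ A : Finset V, A.card = r ^ i → ∀ R, A ⊆ R → R.card ≤ 5 + 3 * r ^ (i + 1) →
    12 + 6 * r ^ (i + 1) < (E ∩ cutPairs A R).card

/-- Every set of `s` vertices spans many edges, and few sets of `k` of these edges contain no
copy. -/
def FewCopyFreeSets (Ed : Finset (Sym2 β)) (s k M : ℕ) (E : Finset (Sym2 V)) : Prop :=
  ∀ S : Finset V, S.card = s → M + 2 * k + (12 + 6 * s) ≤ (E ∩ insidePairs S).card ∧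
    k.factorial * ((copyFreeSets Ed S k).filter fun K => K ⊆ E).card < M ^ k

lemma winsFrom_HP_of_tree {H : SimpleGraph β} {v₀ : β} {G : SimpleGraph V} {E : Finset (Sym2 V)}
    {k M : ℕ} {S : Finset V} {L : ℕ}
    (hmany : M + 2 * k + L ≤ (E ∩ insidePairs S).card)
    (hfew : k.factorial * ((copyFreeSets H.edgeFinset S k).filter fun K => K ⊆ E).card < M ^ k)
    {rem C : Finset (Sym2 V)} (hrem : rem ⊆ E) (hC : C ⊆ E) (hcard : E.card ≤ rem.card + L)
    (hdone : ∀ C' : Finset (Sym2 V), C ⊆ C' → C' ⊆ E → ∀ f : β ↪ S,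
      imageEdges H.edgeFinset f ⊆ C' → ∃ A ∈ copyFinsets (HP H v₀) G, A ⊆ C') :
    WinsFrom (copyFinsets (HP H v₀) G) rem C := by
  refine WinsFrom.avoid (E ∩ insidePairs S)
    ((copyFreeSets H.edgeFinset S k).filter fun K => K ⊆ E) M (Nat.cast_nonneg _) k
    (fun K hK => ?_) C ?_ k rem C ∅ subset_rfl Finset.subset_union_left (Finset.empty_subset _)
    (Finset.empty_subset _) (Finset.disjoint_empty_left _) (by simp) ?_ ?_
  · exact (Finset.mem_powersetCard.mp (Finset.mem_filter.mp (Finset.mem_filter.mp hK).1).1).2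
  · intro rem' C' D hCC' hC' hDC' hDF hDk hDB
    have hC'E : C' ⊆ E := hC'.trans (Finset.union_subset hC Finset.inter_subset_left)
    have : ¬ ∀ f : β ↪ S, ¬ imageEdges H.edgeFinset f ⊆ D := fun h => hDB
      (Finset.mem_filter.mpr ⟨Finset.mem_filter.mpr ⟨Finset.mem_powersetCard.mpr
        ⟨hDF.trans Finset.inter_subset_right, hDk⟩, h⟩, hDF.trans Finset.inter_subset_left⟩)
    push Not at this
    obtain ⟨f, hf⟩ := this
    exact WinsFrom.of_done (hdone C' hCC' hC'E f (hf.trans hDC'))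
  · have h1 := Finset.card_sdiff_add_card_eq_card hrem
    have h2 : (E ∩ insidePairs S).card ≤ (rem ∩ (E ∩ insidePairs S)).card + (E \ rem).card := by
      refine le_trans (Finset.card_le_card fun e he => ?_) (Finset.card_union_le _ _)
      by_cases h : e ∈ rem
      · exact Finset.mem_union_left _ (Finset.mem_inter.mpr ⟨h, he⟩)
      · exact Finset.mem_union_right _
          (Finset.mem_sdiff.mpr ⟨(Finset.mem_inter.mp he).1, h⟩)
    have h3 : M + 2 * k ≤ (rem ∩ (E ∩ insidePairs S)).card := by omega
    exact_mod_cast h3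
  · simp only [Finset.empty_subset, Finset.filter_true]
    exact_mod_cast hfew

/-- A deterministic condition under which Maker wins the `H_P`-game. -/
theorem makerWinsHGame_HP_of_spread {H : SimpleGraph β} {v₀ : β} {G : SimpleGraph V}
    {E : Finset (Sym2 V)} (hE : ∀ e, e ∈ E ↔ e ∈ G.edgeSet) {r k M : ℕ} (hr : 0 < r)
    (hK5 : ∃ f : Fin 5 ↪ (Finset.univ : Finset V), imageEdges nearK5 f ⊆ E)
    (hcut : ManyCutEdges r E) (hfew : FewCopyFreeSets H.edgeFinset (r ^ 3) k M E) :
    MakerWinsHGame (HP H v₀) G := by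
  have hEG : G.edgeSet.toFinset = E := by
    ext e
    simp [hE]
  unfold MakerWinsHGame MakerWins
  rw [hEG]
  change WinsFrom (copyFinsets (HP H v₀) G) E ∅
  obtain ⟨f, hf⟩ := hK5
  have hr2 : r ≤ r ^ 2 := Nat.le_self_pow (by norm_num) r
  have hr3 : r ^ 2 ≤ r ^ 3 := Nat.pow_le_pow_right hr (by norm_num)
  have hne : ∀ i j : Fin 5, i ≠ j → (f i : V) ≠ f j := fun i j hij h =>
    hij (f.injective (Subtype.ext h))
  have he : ∀ i j : Fin 5, s(i, j) ∈ nearK5 → s((f i : V), (f j : V)) ∈ E := fun i j hij =>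
    hf (Finset.mem_image.mpr ⟨s(i, j), hij, rfl⟩)
  set Q : Finset V := Finset.univ.image fun i => (f i : V) with hQ
  have hQcard : Q.card ≤ 5 := Finset.card_image_le
  have hmem : ∀ i, (f i : V) ∈ Q := fun i => Finset.mem_image_of_mem _ (Finset.mem_univ i)
  refine HasTriangleIn.wins (hmem 0) (hmem 1) (hmem 2) (hmem 3) (hmem 4)
    (hne 0 1 (by decide)) (hne 0 2 (by decide)) (hne 0 3 (by decide)) (hne 0 4 (by decide))
    (hne 1 2 (by decide)) (hne 1 3 (by decide)) (hne 1 4 (by decide)) (hne 2 3 (by decide))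
    (hne 2 4 (by decide)) (hne 3 4 (by decide)) ?_
    (he 0 1 (by decide)) (he 0 2 (by decide)) (he 0 3 (by decide)) (he 0 4 (by decide))
    (he 1 2 (by decide)) (he 1 3 (by decide)) (he 1 4 (by decide)) (he 2 3 (by decide))
    (he 2 4 (by decide))
  rintro rem₀ C₀ hrem₀ hC₀ hcard₀ ⟨x, hx, y, hy, z, hz, hxy, hxz, hyz, exy, exz, eyz⟩
  refine WinsFrom.grow (E := E) (A := {x}) (R₀ := Q) (L := 12) (a := r) ?_ C₀ ?_ r rem₀ C₀ hrem₀
    hC₀ subset_rfl ∅ (by simp) (by simpa using hcard₀) (Finset.disjoint_empty_left _) (by simp)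
  · intro R hR hRc
    have := hcut 0 (by norm_num) {x} (by simp) R
      (Finset.singleton_subset_iff.mpr (hR hx)) (by rw [zero_add, pow_one]; omega)
    rw [zero_add, pow_one] at this
    omega
  intro rem₁ C₁ hrem₁ hC₁ hC₀₁ hcard₁ A₁ hA₁ hdisj₁ hadj₁
  have hR₁ : (Q ∪ A₁).card ≤ 5 + r := (Finset.card_union_le _ _).trans (by omega)
  refine WinsFrom.grow (E := E) (A := A₁) (R₀ := Q ∪ A₁) (L := 12 + 2 * r) (a := r ^ 2) ?_ C₁ ?_
    (r ^ 2) rem₁ C₁ hrem₁ hC₁ subset_rfl ∅ (by simp) (by simpa using hcard₁)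
    (Finset.disjoint_empty_left _) (by simp)
  · intro R hR hRc
    have := hcut 1 (by norm_num) A₁ (by simpa using hA₁) R
      (Finset.subset_union_right.trans hR) (by norm_num; omega)
    norm_num at this
    omega
  intro rem₂ C₂ hrem₂ hC₂ hC₁₂ hcard₂ A₂ hA₂ hdisj₂ hadj₂
  have hR₂ : (Q ∪ A₁ ∪ A₂).card ≤ 5 + r + r ^ 2 := (Finset.card_union_le _ _).trans (by omega)
  refine WinsFrom.grow (E := E) (A := A₂) (R₀ := Q ∪ A₁ ∪ A₂) (L := 12 + 2 * r + 2 * r ^ 2)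
    (a := r ^ 3) ?_ C₂ ?_ (r ^ 3) rem₂ C₂ hrem₂ hC₂ subset_rfl ∅ (by simp) (by simpa using hcard₂)
    (Finset.disjoint_empty_left _) (by simp)
  · intro R hR hRc
    have := hcut 2 (by norm_num) A₂ hA₂ R
      (Finset.subset_union_right.trans hR) (by norm_num; omega)
    norm_num at this
    omega
  intro rem₃ C₃ hrem₃ hC₃ hC₂₃ hcard₃ S hS hdisj₃ hadj₃
  obtain ⟨hmany, hfew'⟩ := hfew S hS
  refine winsFrom_HP_of_tree hmany hfew' hrem₃ hC₃ (by omega) ?_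
  intro C' hCC' hC'E g hg
  have hS' : ∀ v ∈ Q ∪ A₁ ∪ A₂, v ∉ S := fun v hv hvS => Finset.disjoint_left.mp hdisj₃ hvS hv
  have hA₂' : ∀ v ∈ Q ∪ A₁, v ∉ A₂ := fun v hv hvS => Finset.disjoint_left.mp hdisj₂ hvS hv
  have hA₁' : ∀ v ∈ Q, v ∉ A₁ := fun v hv hvS => Finset.disjoint_left.mp hdisj₁ hvS hv
  obtain ⟨b, hb, eb⟩ := hadj₃ _ (g v₀).2
  obtain ⟨a, ha, eab⟩ := hadj₂ b hb
  obtain ⟨x', hx', exa⟩ := hadj₁ a ha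
  rw [Finset.mem_singleton] at hx'
  subst hx'
  have hQ1 : ∀ w ∈ Q, w ≠ a := fun w hw h => hA₁' w hw (h ▸ ha)
  have hQ2 : ∀ w ∈ Q ∪ A₁, w ≠ b := fun w hw h => hA₂' w hw (h ▸ hb)
  have hQA : ∀ w ∈ Q, w ∈ Q ∪ A₁ := fun w hw => Finset.mem_union_left _ hw
  have hQAA : ∀ w ∈ Q, w ∈ Q ∪ A₁ ∪ A₂ := fun w hw => Finset.mem_union_left _ (hQA w hw)
  have haA : a ∈ Q ∪ A₁ := Finset.mem_union_right _ ha
  have h2 : C₂ ⊆ C' := hC₂₃.trans hCC'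
  have h1 : C₁ ⊆ C' := hC₁₂.trans h2
  have h0 : C₀ ⊆ C' := hC₀₁.trans h1
  exact exists_mem_copyFinsets_HP (fun e he => (hE e).mp (hC'E he)) g hg hxy hxz (hQ1 _ hx)
    (hQ2 _ (hQA _ hx)) hyz (hQ1 _ hy) (hQ2 _ (hQA _ hy)) (hQ1 _ hz) (hQ2 _ (hQA _ hz))
    (hQ2 _ haA) (hS' _ (hQAA _ hx)) (hS' _ (hQAA _ hy)) (hS' _ (hQAA _ hz))
    (hS' _ (Finset.mem_union_left _ haA)) (hS' _ (Finset.mem_union_right _ hb))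
    (h0 exy) (h0 exz) (h0 eyz) (h1 exa) (h2 eab) (hCC' eb)

end Deterministic

/-! ### The random graph as a random set of pairs -/

section Gnp

variable {V : Type*} [Fintype V]

/-- The probability that a pair of vertices is an edge of `G(n,p)`. -/
def pairProb (V : Type*) [Fintype V] (p : ℝ) : Sym2 V → ℝ := fun e =>
  if e ∈ insidePairs (Finset.univ : Finset V) then p else 0

lemma pairProb_nonneg {p : ℝ} (hp : 0 ≤ p) (e : Sym2 V) :
    0 ≤ pairProb V p e := by
  unfold pairProb
  split_ifs <;> simp [hp]

lemma pairProb_le_one {p : ℝ} (hp : p ≤ 1) (e : Sym2 V) :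
    pairProb V p e ≤ 1 := by
  unfold pairProb
  split_ifs <;> simp [hp]

lemma pairProb_of_not_isDiag {p : ℝ} {e : Sym2 V} (he : ¬ e.IsDiag) :
    pairProb V p e = p := by
  simp [pairProb, mem_insidePairs, he]

lemma edgeSet_fromEdgeSet_of_subset {R : Finset (Sym2 V)}
    (hR : R ⊆ insidePairs (Finset.univ : Finset V)) :
    (SimpleGraph.fromEdgeSet (R : Set (Sym2 V))).edgeSet = R := by
  rw [SimpleGraph.edgeSet_fromEdgeSet]
  ext e
  simp only [Set.mem_sdiff, Finset.mem_coe]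
  exact ⟨fun h => h.1, fun h => ⟨h, (mem_insidePairs.mp (hR h)).1⟩⟩

/-- The probability of the event `Q` for the edge set of a random graph on `V`. -/
def pairPr (V : Type*) [Fintype V] (p : ℝ) (Q : Finset (Sym2 V) → Prop) : ℝ :=
  subsetPr (pairProb V p) Q

lemma pairPr_le_one {p : ℝ} (hp0 : 0 ≤ p) (hp1 : p ≤ 1) (Q : Finset (Sym2 V) → Prop) :
    pairPr V p Q ≤ 1 :=
  subsetPr_le_one (pairProb_nonneg hp0) (pairProb_le_one hp1) Q

lemma pairPr_or_le {p : ℝ} (hp0 : 0 ≤ p) (hp1 : p ≤ 1) (P Q : Finset (Sym2 V) → Prop) :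
    pairPr V p (fun R => P R ∨ Q R) ≤ pairPr V p P + pairPr V p Q :=
  subsetPr_or_le (pairProb_nonneg hp0) (pairProb_le_one hp1) P Q

lemma edgeSet_toFinset_subset_insidePairs (G : SimpleGraph V) :
    G.edgeSet.toFinset ⊆ insidePairs (Finset.univ : Finset V) := fun _ he =>
  mem_insidePairs.mpr
    ⟨G.not_isDiag_of_mem_edgeSet (Set.mem_toFinset.mp he), fun x _ => Finset.mem_univ x⟩

lemma sum_simpleGraph_eq_pairPr [Fintype (SimpleGraph V)] (p : ℝ) (P : SimpleGraph V → Prop) :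
    (∑ G : SimpleGraph V, if P G then
      p ^ numEdges G * (1 - p) ^ ((Fintype.card V).choose 2 - numEdges G) else 0) =
      pairPr V p fun R => P (SimpleGraph.fromEdgeSet (R : Set (Sym2 V))) := by
  have hsub : pairPr V p (fun R => P (SimpleGraph.fromEdgeSet (R : Set (Sym2 V)))) =
      ∑ R ∈ (insidePairs (Finset.univ : Finset V)).powerset,
        subsetWeight (pairProb V p) R *
          if P (SimpleGraph.fromEdgeSet (R : Set (Sym2 V))) then 1 else 0 := by
    refine (Finset.sum_subset (Finset.subset_univ _) fun R _ hR => ?_).symm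
    obtain ⟨e, heR, he⟩ := Finset.not_subset.mp (fun h => hR (Finset.mem_powerset.mpr h))
    rw [subsetWeight, Finset.prod_eq_zero (Finset.mem_univ e) (by simp [heR, pairProb, he]),
      zero_mul]
  rw [hsub]
  refine Finset.sum_bij' (fun G _ => G.edgeSet.toFinset)
    (fun R _ => SimpleGraph.fromEdgeSet (R : Set (Sym2 V))) ?_ ?_ ?_ ?_ ?_
  · exact fun G _ => Finset.mem_powerset.mpr (edgeSet_toFinset_subset_insidePairs G)
  · exact fun R _ => Finset.mem_univ _
  · intro G _
    simp
  · intro R hR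
    ext e
    simp only [Set.mem_toFinset]
    exact Set.ext_iff.mp (edgeSet_fromEdgeSet_of_subset (Finset.mem_powerset.mp hR)) e
  · intro G _
    have hw := subsetWeight_inside (edgeSet_toFinset_subset_insidePairs G) p
    rw [card_insidePairs, Finset.card_univ] at hw
    have hn : numEdges G = G.edgeSet.toFinset.card := Set.ncard_eq_toFinset_card' _
    have hw' : subsetWeight (pairProb V p) G.edgeSet.toFinset =
        p ^ numEdges G * (1 - p) ^ ((Fintype.card V).choose 2 - numEdges G) := by
      rw [hn, ← hw]
      rfl
    rw [hw', Set.coe_toFinset, SimpleGraph.fromEdgeSet_edgeSet]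
    simp

lemma one_sub_le_pairPr {p : ℝ} (hp0 : 0 ≤ p) (hp1 : p ≤ 1)
    {P : SimpleGraph V → Prop} {Q : Finset (Sym2 V) → Prop}
    (h : ∀ (G : SimpleGraph V) (E : Finset (Sym2 V)),
      (∀ e, e ∈ E ↔ e ∈ G.edgeSet) → ¬ Q E → P G) :
    1 - pairPr V p Q ≤ pairPr V p fun R => P (SimpleGraph.fromEdgeSet (R : Set (Sym2 V))) := by
  have h0 := pairProb_nonneg (V := V) hp0
  have h1 := pairProb_le_one (V := V) hp1
  rw [sub_le_iff_le_add, ← sum_subsetWeight (π := pairProb V p), pairPr, pairPr, subsetPr, subsetPr,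
    subsetEx, subsetEx, ← Finset.sum_add_distrib]
  refine Finset.sum_le_sum fun R _ => ?_
  by_cases hR : R ⊆ insidePairs (Finset.univ : Finset V)
  · rw [← mul_add]
    refine le_mul_of_one_le_right (subsetWeight_nonneg h0 h1 R) ?_
    by_cases hQ : Q R
    · rw [if_pos hQ]
      split_ifs <;> norm_num
    · rw [if_pos (h _ R (fun e => by rw [edgeSet_fromEdgeSet_of_subset hR, Finset.mem_coe]) hQ),
        if_neg hQ, add_zero]
  · obtain ⟨e, heR, he⟩ := Finset.not_subset.mp hR
    rw [subsetWeight, Finset.prod_eq_zero (Finset.mem_univ e) (by simp [heR, pairProb, he])]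
    simp

lemma gnpProb_le_one {n : ℕ} {p : ℝ} (hp0 : 0 ≤ p) (hp1 : p ≤ 1)
    (P : SimpleGraph (Fin n) → Prop) : gnpProb n p P ≤ 1 := by
  have h := sum_simpleGraph_eq_pairPr p P
  rw [Fintype.card_fin] at h
  rw [gnpProb, h]
  exact pairPr_le_one hp0 hp1 _

lemma one_sub_le_gnpProb {n : ℕ} {p : ℝ} (hp0 : 0 ≤ p) (hp1 : p ≤ 1)
    {P : SimpleGraph (Fin n) → Prop} {Q : Finset (Sym2 (Fin n)) → Prop}
    (h : ∀ (G : SimpleGraph (Fin n)) (E : Finset (Sym2 (Fin n))),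
      (∀ e, e ∈ E ↔ e ∈ G.edgeSet) → ¬ Q E → P G) :
    1 - pairPr (Fin n) p Q ≤ gnpProb n p P := by
  have h' := sum_simpleGraph_eq_pairPr p P
  rw [Fintype.card_fin] at h'
  rw [gnpProb, h']
  exact one_sub_le_pairPr hp0 hp1 h

end Gnp

/-! ### Failure probabilities -/

section Failure

variable {V : Type*} [Fintype V] [Fintype β]

lemma card_le_choose_two {Ed : Finset (Sym2 β)} (hEd : ∀ e ∈ Ed, ¬ e.IsDiag) {T : Finset β}
    {D : Finset (Sym2 β)} (hD : D ⊆ Ed) (hT : ∀ e ∈ D, ∀ x ∈ e, x ∈ T) :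
    D.card ≤ T.card.choose 2 := by
  rw [← card_insidePairs]
  exact Finset.card_le_card fun e he => mem_insidePairs.mpr ⟨hEd e (hD he), hT e he⟩

lemma not_isDiag_of_mem_nearK5 : ∀ e ∈ nearK5, ¬ e.IsDiag := by
  simp [nearK5]

lemma card_nearK5_le : nearK5.card ≤ 9 := by
  decide

lemma nearK5_density {T : Finset (Fin 5)} {D : Finset (Sym2 (Fin 5))} (hD : D ⊆ nearK5)
    (hT : ∀ e ∈ D, ∀ x ∈ e, x ∈ T) : 5 * D.card ≤ 9 * T.card := by
  have h1 := card_le_choose_two not_isDiag_of_mem_nearK5 hD hT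
  have h2 := (Finset.card_le_card hD).trans card_nearK5_le
  have h3 : T.card ≤ 5 := by simpa using Finset.card_le_univ T
  generalize D.card = d at h1 h2 ⊢
  generalize T.card = m at h1 h3 ⊢
  interval_cases m <;> simp [Nat.choose] at h1 <;> omega

lemma pairPr_no_nearK5_le {p : ℝ} (hp0 : 0 ≤ p) (hp1 : p ≤ 1) (hn : 10 ≤ Fintype.card V)
    (hp : 1 ≤ p * (Fintype.card V : ℝ) ^ (5 / 9 : ℝ)) :
    pairPr V p (fun R => ∀ f : Fin 5 ↪ (Finset.univ : Finset V), ¬ imageEdges nearK5 f ⊆ R) ≤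
      Real.exp (-(p * (Fintype.card V : ℝ) ^ (5 / 9 : ℝ) / (2 * (4 * (5 + 1)) ^ 5))) := by
  set n : ℝ := (Fintype.card V : ℝ) with hndef
  have hn1 : 1 ≤ n := by
    rw [hndef]
    exact_mod_cast (show 1 ≤ Fintype.card V by omega)
  have hn0 : 0 < n := by linarith
  have hp0' : 0 < p := by
    rcases hp0.eq_or_lt with h | h
    · rw [← h, zero_mul] at hp
      linarith
    · exact h
  have h := subsetPr_no_copy_le (V := V) (π := pairProb V p) (S := Finset.univ)
    not_isDiag_of_mem_nearK5
    (pairProb_nonneg hp0) (pairProb_le_one hp1) (q := p) (Φ := p * n ^ (5 / 9 : ℝ)) hp0'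
    (by positivity) (by simpa using hn) (by rw [Finset.card_univ]; omega)
    (fun e he _ => pairProb_of_not_isDiag he) (fun T D hD hne hT => ?_)
  · unfold pairPr
    simpa using h
  · rw [Finset.card_univ, ← hndef]
    have hdens : (5 : ℝ) * D.card ≤ 9 * T.card := by exact_mod_cast nearK5_density hD hT
    have hpos : 0 < n ^ (5 / 9 : ℝ) := Real.rpow_pos_of_pos hn0 _
    calc p * n ^ (5 / 9 : ℝ) ≤ (p * n ^ (5 / 9 : ℝ)) ^ D.card :=
          le_self_pow₀ hp (Finset.card_pos.mpr hne).ne'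
      _ = p ^ D.card * n ^ ((5 / 9 : ℝ) * D.card) := by
          rw [mul_pow, Real.rpow_mul hn0.le, Real.rpow_natCast]
      _ ≤ p ^ D.card * n ^ (T.card : ℝ) := by
          refine mul_le_mul_of_nonneg_left ?_ (by positivity)
          exact Real.rpow_le_rpow_of_exponent_le hn1 (by linarith)
      _ = _ := by
          rw [Real.rpow_natCast, mul_comm]

lemma sum_pairProb_of_forall {p : ℝ} {F : Finset (Sym2 V)} (hF : ∀ e ∈ F, ¬ e.IsDiag) :
    ∑ e ∈ F, pairProb V p e = F.card * p := by
  rw [Finset.sum_congr rfl fun e he => pairProb_of_not_isDiag (hF e he), Finset.sum_const,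
    nsmul_eq_mul]

lemma not_isDiag_of_mem_cutPairs {A R : Finset V} (h : A ⊆ R) : ∀ e ∈ cutPairs A R, ¬ e.IsDiag := by
  intro e he
  obtain ⟨x, hx, rfl⟩ := Finset.mem_image.mp he
  obtain ⟨h1, h2⟩ := Finset.mem_product.mp hx
  rw [Sym2.mk_isDiag_iff]
  intro h3
  exact Finset.mem_compl.mp h2 (h3 ▸ h h1)

lemma pairPr_few_cutPairs_le {p : ℝ} (hp0 : 0 ≤ p) (hp1 : p ≤ 1) {r i : ℕ} (hr : 0 < r)
    (hi : i < 3) (hn : 20 * r ^ 3 ≤ Fintype.card V)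
    (hnp : 72 * r ≤ (Fintype.card V : ℝ) * p) {A R : Finset V} (hAR : A ⊆ R)
    (hA : A.card = r ^ i) (hR : R.card = 5 + 3 * r ^ (i + 1)) :
    pairPr V p (fun E => (E ∩ cutPairs A R).card ≤ 12 + 6 * r ^ (i + 1)) ≤
      Real.exp (-((r : ℝ) ^ i * (Fintype.card V * p) / 16)) := by
  set n : ℝ := (Fintype.card V : ℝ) with hndef
  have h1 : 1 ≤ r ^ (i + 1) := Nat.one_le_pow _ _ hr
  have h3 : r ^ (i + 1) ≤ r ^ 3 := Nat.pow_le_pow_right hr hi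
  have hRn : 2 * R.card ≤ Fintype.card V := by omega
  have hRn' : 2 * (R.card : ℝ) ≤ n := by rw [hndef]; exact_mod_cast hRn
  have hr' : (0 : ℝ) < (r : ℝ) ^ i := by positivity
  have hnp0 : 0 ≤ n * p := by positivity
  have hsum : ∑ e ∈ cutPairs A R, pairProb V p e = (r : ℝ) ^ i * (n - R.card) * p := by
    rw [sum_pairProb_of_forall (not_isDiag_of_mem_cutPairs hAR), card_cutPairs hAR, hA,
      Nat.cast_mul, Nat.cast_sub (by omega), Nat.cast_pow]
  have hlow : (r : ℝ) ^ i * (n * p) / 2 ≤ ∑ e ∈ cutPairs A R, pairProb V p e := by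
    rw [hsum]
    have : n / 2 * p ≤ (n - R.card) * p := mul_le_mul_of_nonneg_right (by linarith) hp0
    nlinarith
  have hch := subsetPr_card_inter_le (pairProb_nonneg hp0) (pairProb_le_one hp1) (cutPairs A R)
    (η := 1 / 2) (by norm_num)
  refine le_trans (subsetPr_mono (pairProb_nonneg hp0) (pairProb_le_one hp1) fun E hE => ?_)
    (hch.trans (Real.exp_le_exp.mpr (by linarith)))
  have hE' : ((E ∩ cutPairs A R).card : ℝ) ≤ 12 + 6 * (r : ℝ) ^ (i + 1) := by exact_mod_cast hE
  have h1' : (1 : ℝ) ≤ (r : ℝ) ^ (i + 1) := by exact_mod_cast h1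
  have h18 : 18 * (r : ℝ) ^ (i + 1) ≤ (r : ℝ) ^ i * (n * p) / 4 := by
    rw [pow_succ]
    nlinarith
  linarith

lemma pairPr_not_manyCutEdges_le {p : ℝ} (hp0 : 0 ≤ p) (hp1 : p ≤ 1) {r : ℕ} (hr : 0 < r)
    (hn : 20 * r ^ 3 ≤ Fintype.card V) (hlog : 1 ≤ Real.log (Fintype.card V))
    (hnp : 272 * r * Real.log (Fintype.card V) ≤ (Fintype.card V : ℝ) * p) :
    pairPr V p (fun E => ¬ ManyCutEdges r E) ≤ 3 / Fintype.card V := by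
  have hr1 : (1 : ℝ) ≤ r := by exact_mod_cast hr
  have hV0 : 0 < Fintype.card V := by
    have : 0 < r ^ 3 := by positivity
    omega
  set n : ℝ := (Fintype.card V : ℝ) with hndef
  have hn0 : 0 < n := by rw [hndef]; exact_mod_cast hV0
  have hn1 : 1 ≤ n := by rw [hndef]; exact_mod_cast hV0
  have h72 : 72 * r ≤ n * p := by nlinarith
  have hone : ∀ i ∈ Finset.range 3,
      pairPr V p (fun E => ∃ AR ∈ ((Finset.univ.powersetCard (r ^ i)) ×ˢ
        (Finset.univ.powersetCard (5 + 3 * r ^ (i + 1)))).filter fun AR : Finset V × Finset V =>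
          AR.1 ⊆ AR.2, (E ∩ cutPairs AR.1 AR.2).card ≤ 12 + 6 * r ^ (i + 1)) ≤ 1 / n := by
    intro i hi
    rw [Finset.mem_range] at hi
    have h1 : 1 ≤ r ^ (i + 1) := Nat.one_le_pow _ _ hr
    have h1' : (1 : ℝ) ≤ (r : ℝ) ^ (i + 1) := by exact_mod_cast h1
    have hri : r ^ i ≤ r ^ (i + 1) := Nat.pow_le_pow_right hr (by omega)
    have hri0 : (0 : ℝ) < (r : ℝ) ^ i := by positivity
    refine (subsetPr_exists_le (pairProb_nonneg hp0) (pairProb_le_one hp1) _ _).trans ?_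
    refine (Finset.sum_le_card_nsmul _ _ (Real.exp (-((r : ℝ) ^ i * (n * p) / 16)))
      fun AR hAR => ?_).trans ?_
    · obtain ⟨h2, h3⟩ := Finset.mem_filter.mp hAR
      obtain ⟨h4, h5⟩ := Finset.mem_product.mp h2
      exact pairPr_few_cutPairs_le hp0 hp1 hr hi hn h72 h3 (Finset.mem_powersetCard.mp h4).2
        (Finset.mem_powersetCard.mp h5).2
    · rw [nsmul_eq_mul]
      have hcard : ((((Finset.univ.powersetCard (r ^ i)) ×ˢ
          (Finset.univ.powersetCard (5 + 3 * r ^ (i + 1)))).filter fun AR : Finset V × Finset V =>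
          AR.1 ⊆ AR.2).card : ℝ) ≤ n ^ (9 * r ^ (i + 1)) := by
        have : (((Finset.univ.powersetCard (r ^ i)) ×ˢ
          (Finset.univ.powersetCard (5 + 3 * r ^ (i + 1)))).filter fun AR : Finset V × Finset V =>
          AR.1 ⊆ AR.2).card ≤ Fintype.card V ^ (9 * r ^ (i + 1)) := by
          refine (Finset.card_filter_le _ _).trans ?_
          rw [Finset.card_product, Finset.card_powersetCard, Finset.card_powersetCard,
            Finset.card_univ]
          refine (Nat.mul_le_mul (Nat.choose_le_pow _ _) (Nat.choose_le_pow _ _)).trans ?_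
          rw [← pow_add]
          exact Nat.pow_le_pow_right hV0 (by omega)
        rw [hndef]
        exact_mod_cast this
      refine (mul_le_mul_of_nonneg_right hcard (Real.exp_pos _).le).trans ?_
      have hexp : n ^ (9 * r ^ (i + 1)) = Real.exp (9 * (r : ℝ) ^ (i + 1) * Real.log n) := by
        rw [← Real.exp_log (pow_pos hn0 _), Real.log_pow]
        push_cast
        rfl
      have hinv : 1 / n = Real.exp (-Real.log n) := by
        rw [Real.exp_neg, Real.exp_log hn0, one_div]
      rw [hexp, hinv, ← Real.exp_add]
      refine Real.exp_le_exp.mpr ?_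
      have h6 : (r : ℝ) ^ i * (272 * r * Real.log n) ≤ (r : ℝ) ^ i * (n * p) :=
        mul_le_mul_of_nonneg_left hnp hri0.le
      have h7 : (r : ℝ) ^ i * (272 * r * Real.log n) = 272 * ((r : ℝ) ^ (i + 1) * Real.log n) := by
        ring
      have h8 : 1 * Real.log n ≤ (r : ℝ) ^ (i + 1) * Real.log n :=
        mul_le_mul_of_nonneg_right h1' (by linarith)
      linarith
  have hfinal : pairPr V p (fun E => ¬ ManyCutEdges r E) ≤
      pairPr V p fun E => ∃ i ∈ Finset.range 3, ∃ AR ∈ ((Finset.univ.powersetCard (r ^ i)) ×ˢ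
        (Finset.univ.powersetCard (5 + 3 * r ^ (i + 1)))).filter fun AR : Finset V × Finset V =>
          AR.1 ⊆ AR.2, (E ∩ cutPairs AR.1 AR.2).card ≤ 12 + 6 * r ^ (i + 1) := by
    refine subsetPr_mono (pairProb_nonneg hp0) (pairProb_le_one hp1) fun E hE => ?_
    unfold ManyCutEdges at hE
    push Not at hE
    obtain ⟨i, hi, A, hA, R, hAR, hR, hE⟩ := hE
    have h3 : r ^ (i + 1) ≤ r ^ 3 := Nat.pow_le_pow_right hr hi
    have h1 : 1 ≤ r ^ (i + 1) := Nat.one_le_pow _ _ hr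
    obtain ⟨R', hR', hcard⟩ := Finset.exists_superset_card_eq hR (by omega)
    refine ⟨i, Finset.mem_range.mpr hi, (A, R'), Finset.mem_filter.mpr ⟨Finset.mem_product.mpr
      ⟨Finset.mem_powersetCard.mpr ⟨Finset.subset_univ _, hA⟩,
        Finset.mem_powersetCard.mpr ⟨Finset.subset_univ _, hcard⟩⟩, hAR.trans hR'⟩, ?_⟩
    exact (Finset.card_le_card (Finset.inter_subset_inter_left (cutPairs_anti hR'))).trans hE
  refine hfinal.trans ((subsetPr_exists_le (pairProb_nonneg hp0) (pairProb_le_one hp1) _ _).trans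
    ((Finset.sum_le_card_nsmul _ _ (1 / n) hone).trans (le_of_eq ?_)))
  rw [Finset.card_range, nsmul_eq_mul]
  push_cast
  ring

lemma pairPr_not_fewCopyFreeSets_le {Ed : Finset (Sym2 β)} (hEd : ∀ e ∈ Ed, ¬ e.IsDiag)
    {p : ℝ} (hp0 : 0 < p) (hp1 : p ≤ 1) {s k M : ℕ} (hk : 0 < k) (hkN : k < s.choose 2)
    (hs : 2 * Fintype.card β ≤ s)
    (hd : ∀ T : Finset β, ∀ D ⊆ Ed, D.Nonempty → (∀ e ∈ D, ∀ x ∈ e, x ∈ T) →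
      (s : ℝ) ^ 2 * (k / s.choose 2) ≤ (s : ℝ) ^ T.card * ((k : ℝ) / s.choose 2) ^ D.card)
    (hM : Real.exp (-copyConst β) * (p * s.choose 2) ≤ M) {η : ℝ} (hη : 0 ≤ η)
    (hsmall : (M : ℝ) + 2 * k + (12 + 6 * s) ≤ (1 - η) * (p * s.choose 2)) :
    pairPr V p (fun E => ¬ FewCopyFreeSets Ed s k M E) ≤
      2 ^ Fintype.card V * (Real.exp (-(η ^ 2 / 2 * (p * s.choose 2))) +
        Real.exp 1 * k * Real.exp (-(copyConst β * k))) := by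
  have h0 := pairProb_nonneg (V := V) hp0.le
  have h1 := pairProb_le_one (V := V) hp1
  set B := Real.exp (-(η ^ 2 / 2 * (p * s.choose 2))) +
        Real.exp 1 * k * Real.exp (-(copyConst β * k)) with hB
  have hB0 : 0 ≤ B := by positivity
  have hone : ∀ S ∈ (Finset.univ : Finset V).powersetCard s,
      pairPr V p (fun E => ((E ∩ insidePairs S).card : ℝ) ≤
          (1 - η) * ∑ e ∈ insidePairs S, pairProb V p e ∨
        M ^ k ≤ k.factorial * ((copyFreeSets Ed S k).filter fun K => K ⊆ E).card) ≤ B := by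
    intro S hS
    obtain ⟨-, hS⟩ := Finset.mem_powersetCard.mp hS
    have hN : (insidePairs S).card = s.choose 2 := by rw [card_insidePairs, hS]
    have hπ : ∀ e ∈ insidePairs S, pairProb V p e = p := fun e he =>
      pairProb_of_not_isDiag (mem_insidePairs.mp he).1
    refine (subsetPr_or_le h0 h1 _ _).trans (add_le_add ?_ ?_)
    · refine (subsetPr_card_inter_le h0 h1 (insidePairs S) hη).trans (le_of_eq ?_)
      rw [Finset.sum_congr rfl hπ, Finset.sum_const, hN, nsmul_eq_mul, mul_comm (_ : ℝ) p]
    · exact subsetPr_many_copyFreeSets_le hEd hk (by rwa [hN]) (by rwa [hS])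
        (by rw [hN, hS]; exact hd) h0 h1 hp0 hπ (by rwa [hN])
  have hle : pairPr V p (fun E => ¬ FewCopyFreeSets Ed s k M E) ≤
      pairPr V p fun E => ∃ S ∈ (Finset.univ : Finset V).powersetCard s,
        ((E ∩ insidePairs S).card : ℝ) ≤ (1 - η) * ∑ e ∈ insidePairs S, pairProb V p e ∨
        M ^ k ≤ k.factorial * ((copyFreeSets Ed S k).filter fun K => K ⊆ E).card := by
    refine subsetPr_mono h0 h1 fun E hE => ?_
    unfold FewCopyFreeSets at hE
    push Not at hE
    obtain ⟨S, hS, hE⟩ := hE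
    refine ⟨S, Finset.mem_powersetCard.mpr ⟨Finset.subset_univ _, hS⟩, ?_⟩
    by_cases h : M + 2 * k + (12 + 6 * s) ≤ (E ∩ insidePairs S).card
    · exact Or.inr (hE h)
    · left
      rw [sum_pairProb_of_forall fun e he => (mem_insidePairs.mp he).1, card_insidePairs, hS]
      have h' : ((E ∩ insidePairs S).card : ℝ) ≤ (M : ℝ) + 2 * k + (12 + 6 * s) := by
        exact_mod_cast (not_le.mp h).le
      linarith
  refine hle.trans ((subsetPr_exists_le h0 h1 _ _).trans
    ((Finset.sum_le_card_nsmul _ _ B hone).trans ?_))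
  rw [nsmul_eq_mul, Finset.card_powersetCard, Finset.card_univ]
  refine mul_le_mul_of_nonneg_right ?_ hB0
  exact_mod_cast Nat.choose_le_two_pow _ _

lemma card_sub_one_le_m2_mul (H : SimpleGraph β) {T : Finset β} {D : Finset (Sym2 β)}
    (hD : D ⊆ H.edgeFinset) (hT : ∀ e ∈ D, ∀ x ∈ e, x ∈ T) (hT3 : 3 ≤ T.card) :
    (D.card : ℝ) - 1 ≤ m2 H * ((T.card : ℝ) - 2) := by
  let J : H.Subgraph :=
    { verts := T
      Adj := fun a b => s(a, b) ∈ D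
      adj_sub := fun h => SimpleGraph.mem_edgeFinset.mp (hD h)
      edge_vert := fun {a b} h => hT _ h a (Sym2.mem_mk_left a b)
      symm := ⟨fun a b h => by rwa [Sym2.eq_swap]⟩ }
  have hJv : J.verts.ncard = T.card := Set.ncard_coe_finset T
  have hJe : J.edgeSet.ncard = D.card := by
    rw [← Set.ncard_coe_finset D]
    congr 1
    ext e
    induction e with
    | _ a b => exact SimpleGraph.Subgraph.mem_edgeSet
  have hT3' : (3 : ℝ) ≤ T.card := by exact_mod_cast hT3
  have hfin : {x : ℝ | ∃ J : H.Subgraph, 3 ≤ J.verts.ncard ∧ x = subD2 J}.Finite :=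
    (Set.finite_range fun J : H.Subgraph => subD2 J).subset fun x ⟨J, _, hx⟩ => ⟨J, hx.symm⟩
  have hle : subD2 J ≤ m2 H := le_csSup hfin.bddAbove ⟨J, by rwa [hJv], rfl⟩
  rw [subD2, hJv, hJe, div_le_iff₀ (by linarith)] at hle
  exact hle

lemma density_bound (H : SimpleGraph β) (hm : 0 < m2 H) {s q : ℝ} (hs : 1 ≤ s) (hq0 : 0 < q)
    (hq1 : q ≤ 1) (hqs : 1 ≤ q * s ^ (1 / m2 H)) (T : Finset β) (D : Finset (Sym2 β))
    (hD : D ⊆ H.edgeFinset) (hne : D.Nonempty) (hT : ∀ e ∈ D, ∀ x ∈ e, x ∈ T) :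
    s ^ 2 * q ≤ s ^ T.card * q ^ D.card := by
  have hs0 : 0 < s := by linarith
  have h1 := card_le_choose_two
    (fun e he => H.not_isDiag_of_mem_edgeSet (SimpleGraph.mem_edgeFinset.mp he)) hD hT
  have hD1 : 1 ≤ D.card := Finset.card_pos.mpr hne
  have hT2 : 2 ≤ T.card := by
    by_contra h
    rw [Nat.choose_eq_zero_of_lt (by omega)] at h1
    omega
  rcases hT2.eq_or_lt with h2 | h3
  · rw [← h2] at h1 ⊢
    have : D.card = 1 := by
      simp at h1
      omega
    rw [this, pow_one]
  · have hdens := card_sub_one_le_m2_mul H hD hT h3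
    have hT3 : (3 : ℝ) ≤ T.card := by exact_mod_cast h3
    have hsq : 1 ≤ s * q ^ m2 H := by
      have h4 := Real.one_le_rpow hqs hm.le
      rw [Real.mul_rpow hq0.le (by positivity), ← Real.rpow_mul hs0.le, one_div,
        inv_mul_cancel₀ hm.ne', Real.rpow_one] at h4
      linarith
    have h5 : 1 ≤ s ^ ((T.card : ℝ) - 2) * q ^ ((D.card : ℝ) - 1) := by
      calc (1 : ℝ) ≤ (s * q ^ m2 H) ^ ((T.card : ℝ) - 2) := Real.one_le_rpow hsq (by linarith)
        _ = s ^ ((T.card : ℝ) - 2) * q ^ (m2 H * ((T.card : ℝ) - 2)) := by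
          rw [Real.mul_rpow hs0.le (by positivity), ← Real.rpow_mul hq0.le]
        _ ≤ _ := mul_le_mul_of_nonneg_left
          (Real.rpow_le_rpow_of_exponent_ge hq0 hq1 hdens) (by positivity)
    have h6 : s ^ T.card * q ^ D.card =
        s ^ 2 * q * (s ^ ((T.card : ℝ) - 2) * q ^ ((D.card : ℝ) - 1)) := by
      rw [Real.rpow_sub hs0, Real.rpow_sub hq0, Real.rpow_natCast, Real.rpow_natCast, Real.rpow_one,
        Real.rpow_two]
      field_simp
    rw [h6]
    exact le_mul_of_one_le_right (by positivity) h5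

end Failure

/-! ### Asymptotics -/

section Asymptotics

open Filter Topology

variable {V : Type*} [Fintype V] [Fintype β]

/-- A small constant depending only on the number of vertices. -/
def slack (β : Type*) [Fintype β] : ℝ := (1 - Real.exp (-copyConst β)) / 4

lemma slack_pos : 0 < slack β := by
  have : Real.exp (-copyConst β) < 1 := by
    rw [Real.exp_lt_one_iff]
    linarith [copyConst_pos (β := β)]
  unfold slack
  linarith

lemma slack_lt_one : slack β < 1 := by
  have := Real.exp_pos (-copyConst β)
  unfold slack
  linarith

lemma exists_pairPr_not_fewCopyFreeSets_le (H : SimpleGraph β) (hm : 0 < m2 H) {p : ℝ} (hp0 : 0 < p)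
    (hp1 : p ≤ 1) {s : ℕ} (hs0 : 0 < s) (hs : 2 * Fintype.card β ≤ s) (hsV : s ≤ Fintype.card V)
    (h1 : 19 * Fintype.card V ≤ slack β * (p * s.choose 2))
    (h2 : 2 * Fintype.card V ≤ slack β ^ 2 / 2 * (p * s.choose 2))
    (h3 : 2 * Fintype.card V ≤ copyConst β * slack β / 4 * (p * s.choose 2))
    (hps : 1 ≤ slack β / 2 * p * (s : ℝ) ^ (1 / m2 H)) :
    ∃ k M : ℕ, pairPr V p (fun E => ¬ FewCopyFreeSets H.edgeFinset s k M E) ≤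
      (1 + 2 * Real.exp 1 / copyConst β) * Real.exp (-Fintype.card V) := by
  have hη0 := slack_pos (β := β)
  have hη1 := slack_lt_one (β := β)
  have hc := copyConst_pos (β := β)
  have hV1 : (1 : ℝ) ≤ Fintype.card V := by exact_mod_cast hs0.trans_le hsV
  have hsV' : (s : ℝ) ≤ Fintype.card V := by exact_mod_cast hsV
  set n : ℝ := (Fintype.card V : ℝ) with hn
  set η := slack β with hη
  set c := copyConst β with hcdef
  set N : ℝ := ((s.choose 2 : ℕ) : ℝ) with hN
  have hpN : 0 < p * N := by
    by_contra h
    nlinarith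
  have hN0 : 0 < N := pos_of_mul_pos_right hpN hp0.le
  set k := ⌊η * (p * N)⌋₊ with hk
  set M := ⌈Real.exp (-c) * (p * N)⌉₊ with hM
  have hk1 : (k : ℝ) ≤ η * (p * N) := Nat.floor_le (by positivity)
  have hk2 : η * (p * N) < k + 1 := Nat.lt_floor_add_one _
  have hk3 : η * (p * N) / 2 ≤ k := by linarith
  have hk0 : (0 : ℝ) < k := by linarith
  have hkN : (k : ℝ) < N := by
    have : p * N ≤ N := mul_le_of_le_one_left hN0.le hp1
    nlinarith
  have hM1 : (M : ℝ) < Real.exp (-c) * (p * N) + 1 := Nat.ceil_lt_add_one (by positivity)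
  have hexpη : Real.exp (-c) = 1 - 4 * η := by
    rw [hη, slack]
    ring
  refine ⟨k, M, (pairPr_not_fewCopyFreeSets_le (η := η)
    (fun e he => H.not_isDiag_of_mem_edgeSet (SimpleGraph.mem_edgeFinset.mp he)) hp0 hp1
    (by exact_mod_cast hk0) (Nat.cast_lt.mp hkN) hs ?_ (Nat.le_ceil _) hη0.le ?_).trans ?_⟩
  · intro T D hD hne hT
    have hq : η / 2 * p ≤ k / N := by
      rw [le_div_iff₀ hN0]
      linarith
    refine density_bound H hm (by exact_mod_cast hs0) (by positivity)
      ((div_le_one hN0).mpr hkN.le) (hps.trans ?_) T D hD hne hT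
    exact mul_le_mul_of_nonneg_right hq (by positivity)
  · rw [hexpη] at hM1
    nlinarith
  · have hA : Real.exp (-(η ^ 2 / 2 * (p * N))) ≤ Real.exp (-(2 * n)) :=
      Real.exp_le_exp.mpr (by linarith)
    have hB : (k : ℝ) * Real.exp (-(c * k)) ≤ 2 / c * Real.exp (-(2 * n)) := by
      have h5 : c * k / 2 ≤ Real.exp (c * k / 2) := by
        linarith [Real.add_one_le_exp (c * k / 2)]
      have h6 : (k : ℝ) ≤ 2 / c * Real.exp (c * k / 2) := by
        rw [div_mul_eq_mul_div, le_div_iff₀ hc]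
        linarith
      have h7 : c * (η * (p * N) / 2) ≤ c * k := mul_le_mul_of_nonneg_left hk3 hc.le
      calc (k : ℝ) * Real.exp (-(c * k))
          ≤ 2 / c * Real.exp (c * k / 2) * Real.exp (-(c * k)) :=
            mul_le_mul_of_nonneg_right h6 (Real.exp_pos _).le
        _ = 2 / c * Real.exp (-(c * k / 2)) := by
            rw [mul_assoc, ← Real.exp_add]
            congr 2
            ring
        _ ≤ _ := mul_le_mul_of_nonneg_left (Real.exp_le_exp.mpr (by linarith)) (by positivity)
    have hC : (2 : ℝ) ^ Fintype.card V ≤ Real.exp n := by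
      have h8 : (2 : ℝ) ≤ Real.exp 1 := by linarith [Real.add_one_le_exp (1 : ℝ)]
      calc (2 : ℝ) ^ Fintype.card V ≤ Real.exp 1 ^ Fintype.card V :=
            pow_le_pow_left₀ (by norm_num) h8 _
        _ = Real.exp n := by rw [← Real.exp_nat_mul, mul_one]
    have hD : Real.exp n * Real.exp (-(2 * n)) = Real.exp (-n) := by
      rw [← Real.exp_add]
      congr 1
      ring
    calc (2 : ℝ) ^ Fintype.card V * (Real.exp (-(η ^ 2 / 2 * (p * N))) +
          Real.exp 1 * k * Real.exp (-(c * k)))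
        ≤ Real.exp n * (Real.exp (-(2 * n)) + Real.exp 1 * (2 / c * Real.exp (-(2 * n)))) := by
          rw [mul_assoc (Real.exp 1)]
          gcongr
      _ = (1 + 2 * Real.exp 1 / c) * (Real.exp n * Real.exp (-(2 * n))) := by ring
      _ = _ := by rw [hD]

lemma le_gnpProb_of_bounds (H : SimpleGraph β) (v₀ : β) (hm : 0 < m2 H) {n r : ℕ} {p : ℝ}
    (hp0 : 0 < p) (hp1 : p ≤ 1) (hr : 0 < r) (hn10 : 10 ≤ n) (hrn : 20 * r ^ 3 ≤ n)
    (hp : 1 ≤ p * (n : ℝ) ^ (5 / 9 : ℝ)) (hlog : 1 ≤ Real.log n)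
    (hnp : 272 * r * Real.log n ≤ n * p) (hs : 2 * Fintype.card β ≤ r ^ 3)
    (h1 : 19 * n ≤ slack β * (p * (r ^ 3).choose 2))
    (h2 : 2 * n ≤ slack β ^ 2 / 2 * (p * (r ^ 3).choose 2))
    (h3 : 2 * n ≤ copyConst β * slack β / 4 * (p * (r ^ 3).choose 2))
    (hps : 1 ≤ slack β / 2 * p * ((r ^ 3 : ℕ) : ℝ) ^ (1 / m2 H)) :
    1 - (Real.exp (-(p * (n : ℝ) ^ (5 / 9 : ℝ) / (2 * (4 * (5 + 1)) ^ 5))) + (3 / n +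
      (1 + 2 * Real.exp 1 / copyConst β) * Real.exp (-n))) ≤
      gnpProb n p fun G => MakerWinsHGame (HP H v₀) G := by
  have hcard : Fintype.card (Fin n) = n := Fintype.card_fin n
  obtain ⟨k, M, hkM⟩ := exists_pairPr_not_fewCopyFreeSets_le (V := Fin n) H hm hp0 hp1
    (pow_pos hr 3) hs (by omega) (by rwa [hcard]) (by rwa [hcard]) (by rwa [hcard]) hps
  have hK := pairPr_no_nearK5_le (V := Fin n) hp0.le hp1 (by omega) (by rwa [hcard])
  have hcut := pairPr_not_manyCutEdges_le (V := Fin n) hp0.le hp1 hr (by omega) (by rwa [hcard])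
    (by rwa [hcard])
  rw [hcard] at hK hcut hkM
  refine le_trans ?_ (one_sub_le_gnpProb hp0.le hp1
    (Q := fun E => (∀ f : Fin 5 ↪ (Finset.univ : Finset (Fin n)), ¬ imageEdges nearK5 f ⊆ E) ∨
      ¬ ManyCutEdges r E ∨ ¬ FewCopyFreeSets H.edgeFinset (r ^ 3) k M E) ?_)
  · have h4 := pairPr_or_le (V := Fin n) hp0.le hp1
      (fun E => ∀ f : Fin 5 ↪ (Finset.univ : Finset (Fin n)), ¬ imageEdges nearK5 f ⊆ E)
      (fun E => ¬ ManyCutEdges r E ∨ ¬ FewCopyFreeSets H.edgeFinset (r ^ 3) k M E)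
    have h5 := pairPr_or_le (V := Fin n) hp0.le hp1 (fun E => ¬ ManyCutEdges r E)
      (fun E => ¬ FewCopyFreeSets H.edgeFinset (r ^ 3) k M E)
    linarith
  · intro G E hE hQ
    push Not at hQ
    exact makerWinsHGame_HP_of_spread hE hr hQ.1 hQ.2.1 hQ.2.2

end Asymptotics

section Limit

open Filter Topology

variable [Fintype β]

/-- The parameter governing the size of the trees that Maker builds. -/
def treeParam (n : ℕ) : ℕ := ⌊((n : ℝ) / 20) ^ (1 / 3 : ℝ)⌋₊

lemma treeParam_le (n : ℕ) : (treeParam n : ℝ) ≤ ((n : ℝ) / 20) ^ (1 / 3 : ℝ) :=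
  Nat.floor_le (by positivity)

lemma cube_rpow_third {x : ℝ} (hx : 0 ≤ x) : (x ^ (1 / 3 : ℝ)) ^ 3 = x := by
  rw [← Real.rpow_natCast, ← Real.rpow_mul hx]
  norm_num

lemma twenty_mul_treeParam_pow_le (n : ℕ) : 20 * treeParam n ^ 3 ≤ n := by
  have h := pow_le_pow_left₀ (Nat.cast_nonneg _) (treeParam_le n) 3
  rw [cube_rpow_third (by positivity)] at h
  have h' : 20 * (treeParam n : ℝ) ^ 3 ≤ n := by linarith
  exact_mod_cast h'

lemma one_le_third_root {n : ℕ} (hn : 20 ≤ n) : 1 ≤ ((n : ℝ) / 20) ^ (1 / 3 : ℝ) := by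
  have : (20 : ℝ) ≤ n := by exact_mod_cast hn
  exact Real.one_le_rpow (by linarith) (by norm_num)

lemma treeParam_pos {n : ℕ} (hn : 20 ≤ n) : 0 < treeParam n :=
  Nat.floor_pos.mpr (one_le_third_root hn)

lemma le_treeParam_pow {n : ℕ} (hn : 20 ≤ n) : (n : ℝ) / 160 ≤ ((treeParam n ^ 3 : ℕ) : ℝ) := by
  have h1 : ((n : ℝ) / 20) ^ (1 / 3 : ℝ) < treeParam n + 1 := Nat.lt_floor_add_one _
  have h2 : (1 : ℝ) ≤ treeParam n := by exact_mod_cast treeParam_pos hn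
  have h3 := pow_le_pow_left₀ (by positivity)
    (show ((n : ℝ) / 20) ^ (1 / 3 : ℝ) / 2 ≤ treeParam n by linarith) 3
  rw [div_pow, cube_rpow_third (by positivity)] at h3
  push_cast
  linarith

lemma treeParam_le_rpow (n : ℕ) : (treeParam n : ℝ) ≤ (n : ℝ) ^ (1 / 3 : ℝ) :=
  (treeParam_le n).trans (Real.rpow_le_rpow (by positivity)
    (div_le_self (Nat.cast_nonneg _) (by norm_num)) (by norm_num))

lemma sq_le_choose_treeParam {n : ℕ} (hn : 320 ≤ n) :
    (n : ℝ) ^ 2 / 102400 ≤ (((treeParam n ^ 3).choose 2 : ℕ) : ℝ) := by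
  have hn' : (320 : ℝ) ≤ n := by exact_mod_cast hn
  have h := le_treeParam_pow (show 20 ≤ n by omega)
  rw [Nat.cast_choose_two]
  nlinarith

lemma tendsto_rpow_natCast {y : ℝ} (hy : 0 < y) :
    Tendsto (fun n : ℕ => (n : ℝ) ^ y) atTop atTop :=
  (tendsto_rpow_atTop hy).comp tendsto_natCast_atTop_atTop

lemma tendsto_mul_rpow_of_le {p : ℕ → ℝ} (hp0 : ∀ n, 0 ≤ p n) {t u : ℝ} (htu : t ≤ u)
    (hp : Tendsto (fun n : ℕ => p n * (n : ℝ) ^ t) atTop atTop) :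
    Tendsto (fun n : ℕ => p n * (n : ℝ) ^ u) atTop atTop := by
  refine tendsto_atTop_mono' _ ?_ hp
  filter_upwards [eventually_ge_atTop 1] with n hn
  exact mul_le_mul_of_nonneg_left
    (Real.rpow_le_rpow_of_exponent_le (by exact_mod_cast hn) htu) (hp0 n)

lemma not_tendsto_mul_rpow_nonpos {p : ℕ → ℝ} (hp1 : ∀ n, p n ≤ 1) {t : ℝ} (ht : t ≤ 0) :
    ¬ Tendsto (fun n : ℕ => p n * (n : ℝ) ^ t) atTop atTop := by
  intro h
  obtain ⟨n, h1, h2⟩ := ((h.eventually_ge_atTop 2).and (eventually_ge_atTop 1)).exists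
  have hn : (1 : ℝ) ≤ n := by exact_mod_cast h2
  have h3 : (n : ℝ) ^ t ≤ 1 := Real.rpow_le_one_of_one_le_of_nonpos hn ht
  have h4 : p n * (n : ℝ) ^ t ≤ 1 * 1 := mul_le_mul (hp1 n) h3 (by positivity) (by norm_num)
  linarith

lemma rpow_four_ninths_le {n : ℕ} (hn : 0 < n) {p : ℝ} (hp : 1 ≤ p * (n : ℝ) ^ (5 / 9 : ℝ)) :
    (n : ℝ) ^ (4 / 9 : ℝ) ≤ n * p := by
  have hn0 : (0 : ℝ) < n := by exact_mod_cast hn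
  have h : (n : ℝ) = (n : ℝ) ^ (4 / 9 : ℝ) * (n : ℝ) ^ (5 / 9 : ℝ) := by
    rw [← Real.rpow_add hn0]
    norm_num
  calc (n : ℝ) ^ (4 / 9 : ℝ) = (n : ℝ) ^ (4 / 9 : ℝ) * 1 := (mul_one _).symm
    _ ≤ (n : ℝ) ^ (4 / 9 : ℝ) * (p * (n : ℝ) ^ (5 / 9 : ℝ)) :=
        mul_le_mul_of_nonneg_left hp (by positivity)
    _ = ((n : ℝ) ^ (4 / 9 : ℝ) * (n : ℝ) ^ (5 / 9 : ℝ)) * p := by ring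
    _ = n * p := by rw [← h]

lemma eventually_log_le :
    ∀ᶠ n : ℕ in atTop, 272 * treeParam n * Real.log n ≤ (n : ℝ) ^ (4 / 9 : ℝ) := by
  have h := (isLittleO_log_rpow_atTop (show (0 : ℝ) < 1 / 9 by norm_num)).bound
    (show (0 : ℝ) < 1 / 272 by norm_num)
  filter_upwards [tendsto_natCast_atTop_atTop.eventually h, eventually_ge_atTop 1] with n h1 h2
  have hn : (1 : ℝ) ≤ n := by exact_mod_cast h2
  have hlog : 0 ≤ Real.log n := Real.log_nonneg hn
  rw [Real.norm_of_nonneg hlog, Real.norm_of_nonneg (by positivity)] at h1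
  calc 272 * (treeParam n : ℝ) * Real.log n
      ≤ 272 * (n : ℝ) ^ (1 / 3 : ℝ) * (1 / 272 * (n : ℝ) ^ (1 / 9 : ℝ)) :=
        mul_le_mul (mul_le_mul_of_nonneg_left (treeParam_le_rpow n) (by norm_num)) h1 hlog
          (by positivity)
    _ = (n : ℝ) ^ (1 / 3 : ℝ) * (n : ℝ) ^ (1 / 9 : ℝ) := by ring
    _ = (n : ℝ) ^ (4 / 9 : ℝ) := by
        rw [← Real.rpow_add (by linarith)]
        norm_num

lemma eventually_linear_le {p : ℕ → ℝ} {a b : ℝ} (hb : 0 < b)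
    (hp : Tendsto (fun n : ℕ => p n * (n : ℝ) ^ (5 / 9 : ℝ)) atTop atTop) :
    ∀ᶠ n : ℕ in atTop, a * n ≤ b * (p n * (treeParam n ^ 3).choose 2) := by
  filter_upwards [hp.eventually_ge_atTop 1, eventually_ge_atTop 320,
    (tendsto_rpow_natCast (show (0 : ℝ) < 4 / 9 by norm_num)).eventually_ge_atTop
      (a * 102400 / b)] with n h1 h2 h3
  have hn : (0 : ℝ) < n := by exact_mod_cast (show 0 < n by omega)
  have h4 := rpow_four_ninths_le (show 0 < n by omega) h1
  have h5 := sq_le_choose_treeParam h2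
  have hp0 : 0 ≤ p n := by
    by_contra h
    have := mul_neg_of_pos_of_neg hn (not_le.mp h)
    have : 0 ≤ (n : ℝ) ^ (4 / 9 : ℝ) := by positivity
    linarith
  rw [div_le_iff₀ hb] at h3
  have h6 : a * 102400 ≤ n * p n * b := h3.trans (mul_le_mul_of_nonneg_right h4 hb.le)
  calc a * n = a * 102400 * n / 102400 := by ring
    _ ≤ n * p n * b * n / 102400 := by gcongr
    _ = b * (p n * ((n : ℝ) ^ 2 / 102400)) := by ring
    _ ≤ _ := by gcongr

lemma eventually_one_le_density {p : ℕ → ℝ} (hp0 : ∀ n, 0 ≤ p n) {b u : ℝ} (hb : 0 < b) (hu : 0 ≤ u)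
    (hp : Tendsto (fun n : ℕ => p n * (n : ℝ) ^ u) atTop atTop) :
    ∀ᶠ n : ℕ in atTop, 1 ≤ b * p n * ((treeParam n ^ 3 : ℕ) : ℝ) ^ u := by
  filter_upwards [hp.eventually_ge_atTop ((160 : ℝ) ^ u / b), eventually_ge_atTop 20] with n h1 h2
  have h160 : (0 : ℝ) < 160 ^ u := by positivity
  have h3 := Real.rpow_le_rpow (by positivity) (le_treeParam_pow h2) hu
  rw [Real.div_rpow (Nat.cast_nonneg _) (by norm_num)] at h3
  rw [div_le_iff₀ hb] at h1
  calc (1 : ℝ) = 160 ^ u / 160 ^ u := (div_self h160.ne').symm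
    _ ≤ p n * (n : ℝ) ^ u * b / 160 ^ u := by gcongr
    _ = b * p n * ((n : ℝ) ^ u / 160 ^ u) := by ring
    _ ≤ _ := mul_le_mul_of_nonneg_left h3 (mul_nonneg hb.le (hp0 n))

lemma eventually_le_treeParam_pow (m : ℕ) : ∀ᶠ n : ℕ in atTop, m ≤ treeParam n ^ 3 := by
  filter_upwards [eventually_ge_atTop 20, eventually_ge_atTop (160 * m)] with n h1 h2
  have h3 := le_treeParam_pow h1
  have h4 : (160 : ℝ) * m ≤ n := by exact_mod_cast h2
  have h5 : (m : ℝ) ≤ ((treeParam n ^ 3 : ℕ) : ℝ) := by linarith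
  exact_mod_cast h5

theorem tendsto_gnpProb_makerWins (H : SimpleGraph β) (v₀ : β) {t : ℝ}
    (ht : t = min (5 / 9 : ℝ) (1 / m2 H)) {p : ℕ → ℝ} (hp0 : ∀ n, 0 ≤ p n) (hp1 : ∀ n, p n ≤ 1)
    (hp : Tendsto (fun n : ℕ => p n * (n : ℝ) ^ t) atTop atTop) :
    Tendsto (fun n => gnpProb n (p n) fun G => MakerWinsHGame (HP H v₀) G) atTop (𝓝 1) := by
  have hm : 0 < m2 H := by
    by_contra h
    refine not_tendsto_mul_rpow_nonpos hp1 ?_ hp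
    rw [ht]
    exact (min_le_right _ _).trans (one_div_nonpos.mpr (not_lt.mp h))
  have hpK := tendsto_mul_rpow_of_le hp0 (ht.le.trans (min_le_left _ _)) hp
  have hpm := tendsto_mul_rpow_of_le hp0 (ht.le.trans (min_le_right _ _)) hp
  have hη := slack_pos (β := β)
  have hc := copyConst_pos (β := β)
  have hlim : Tendsto (fun n : ℕ =>
      1 - (Real.exp (-(p n * (n : ℝ) ^ (5 / 9 : ℝ) / (2 * (4 * (5 + 1)) ^ 5))) + (3 / (n : ℝ) +
      (1 + 2 * Real.exp 1 / copyConst β) * Real.exp (-(n : ℝ))))) atTop (𝓝 1) := by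
    have hA : Tendsto (fun n : ℕ =>
        Real.exp (-(p n * (n : ℝ) ^ (5 / 9 : ℝ) / (2 * (4 * (5 + 1)) ^ 5)))) atTop (𝓝 0) :=
      Real.tendsto_exp_neg_atTop_nhds_zero.comp (hpK.atTop_div_const (by norm_num))
    have hB : Tendsto (fun n : ℕ => 3 / (n : ℝ)) atTop (𝓝 0) :=
      tendsto_const_div_atTop_nhds_zero_nat 3
    have hC : Tendsto (fun n : ℕ => Real.exp (-(n : ℝ))) atTop (𝓝 0) :=
      Real.tendsto_exp_neg_atTop_nhds_zero.comp tendsto_natCast_atTop_atTop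
    have h := (hA.add (hB.add (hC.const_mul (1 + 2 * Real.exp 1 / copyConst β)))).const_sub 1
    simpa using h
  refine tendsto_of_tendsto_of_tendsto_of_le_of_le' hlim tendsto_const_nhds ?_
    (Eventually.of_forall fun n => gnpProb_le_one (hp0 n) (hp1 n) _)
  have hlog : ∀ᶠ n : ℕ in atTop, 1 ≤ Real.log n :=
    (Real.tendsto_log_atTop.comp tendsto_natCast_atTop_atTop).eventually_ge_atTop 1
  filter_upwards [eventually_ge_atTop 20, hpK.eventually_ge_atTop 1, hlog, eventually_log_le,
    eventually_le_treeParam_pow (2 * Fintype.card β), eventually_linear_le (a := 19) hη hpK,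
    eventually_linear_le (a := 2) (b := slack β ^ 2 / 2) (by positivity) hpK,
    eventually_linear_le (a := 2) (b := copyConst β * slack β / 4) (by positivity) hpK,
    eventually_one_le_density hp0 (b := slack β / 2) (by positivity)
      (one_div_nonneg.mpr hm.le) hpm] with n hn h1 h2 h3 h4 h5 h6 h7 h8
  have hpn : 0 < p n := by
    rcases (hp0 n).eq_or_lt with h | h
    · rw [← h, zero_mul] at h1
      linarith
    · exact h
  exact le_gnpProb_of_bounds H v₀ hm hpn (hp1 n) (treeParam_pos hn) (by omega)
    (twenty_mul_treeParam_pow_le n) h1 h2 (h3.trans (rpow_four_ninths_le (by omega) h1)) h4 h5 h6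
    h7 h8

end Limit

/-- 1-statement for the `H_P`-game. Let `H` satisfy the conditions
of the main theorem, and `t = min {5/9, 1/m₂(H)}`. If `p·n^t → ∞`, then w.h.p. Maker
(moving first) wins the `H_P`-game on `G(n,p)`. -/
theorem maker_wins_HP_game {β : Type*} [Fintype β]
    (H : SimpleGraph β) (hH : GoodGraph H) (v₀ : β)
    (t : ℝ) (ht : t = min (5 / 9 : ℝ) (1 / m2 H))
    (p : ℕ → ℝ) (hp0 : ∀ n, 0 ≤ p n) (hp1 : ∀ n, p n ≤ 1)
    (hp : Filter.Tendsto (fun n : ℕ => p n * (n : ℝ) ^ t) Filter.atTop Filter.atTop) :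
    Filter.Tendsto (fun n => gnpProb n (p n) fun G => MakerWinsHGame (HP H v₀) G)
      Filter.atTop (nhds 1) := by
  exact tendsto_gnpProb_makerWins H v₀ ht hp0 hp1 hp

end HGamePaper
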